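/- arXiv:1907.13036 — 8 statements merged into one kernel-verified Lean document; each statement's English description precedes it below -/
import Mathlib

section
/- Let C be a [v, m, d] linear code over GF(q) whose dual has minimum distance d⊥, let t be a positive integer with 0 < t < min(d, d⊥), and suppose that for every weight k with d ≤ k ≤ v-t the supports of the weight-k codewords (each counted with multiplicity 1/(q-1)) form a t-design on the v coordinate positions. Then for any set T of t coordinates, the number of codewords of weight k in the shortened code C_T equals A_k(C) · C(k,t) · C(v-t, k) / (C(v,t) · C(v-t, k-t)), where A_k(C) is the number of codewords of weight k in C; in particular this number is independent of the choice of T. -/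
open Finset

variable {F : Type*} [Field F] {ι : Type*} [Fintype ι]

/-- Hamming weight of a vector. -/
noncomputable def wt (c : ι → F) : ℕ := Nat.card {i : ι // c i ≠ 0}

/-- Number of codewords of weight `k` in a linear code `C`. -/
noncomputable def Acount (C : Submodule F (ι → F)) (k : ℕ) : ℕ :=
  Nat.card {c : C // wt (c : ι → F) = k}

/-- `d` is the minimum (Hamming) distance of the code `C`. -/
def IsMinDist (C : Submodule F (ι → F)) (d : ℕ) : Prop :=
  (∃ c ∈ C, c ≠ 0 ∧ wt c = d) ∧ ∀ c ∈ C, c ≠ 0 → d ≤ wt c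

/-- The dual code with respect to the standard inner product. -/
def dualCode (C : Submodule F (ι → F)) : Submodule F (ι → F) where
  carrier := {x | ∀ c ∈ C, ∑ i, x i * c i = 0}
  add_mem' := by
    intro x y hx hy c hc
    simp only [Set.mem_setOf_eq] at *
    simp [Pi.add_apply, add_mul, Finset.sum_add_distrib, hx c hc, hy c hc]
  zero_mem' := by simp
  smul_mem' := by
    intro a x hx c hc
    simp only [Set.mem_setOf_eq] at *
    simp [Pi.smul_apply, smul_eq_mul, mul_assoc, ← Finset.mul_sum, hx c hc]

/-- The submodule of vectors vanishing on `T`. -/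
def vanishOn (T : Finset ι) : Submodule F (ι → F) where
  carrier := {x | ∀ i ∈ T, x i = 0}
  add_mem' := by
    intro x y hx hy i hi
    simp [hx i hi, hy i hi]
  zero_mem' := by intro i _; rfl
  smul_mem' := by
    intro a x hx i hi
    simp [hx i hi]

/-- The punctured code: delete the coordinates in `T`. -/
def punctured (C : Submodule F (ι → F)) (T : Finset ι) :
    Submodule F ({i : ι // i ∉ T} → F) :=
  C.map (LinearMap.funLeft F F (Subtype.val : {i : ι // i ∉ T} → ι))

/-- The shortened code: codewords vanishing on `T`, with the coordinates in `T` deleted. -/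
def shortened (C : Submodule F (ι → F)) (T : Finset ι) :
    Submodule F ({i : ι // i ∉ T} → F) :=
  punctured (C ⊓ vanishOn T) T

/-- The supports of the weight-`k` codewords of `C` (with multiplicities divided by `q-1`)
form a `t`-design: every `t`-set of coordinates lies in the same number of supports. -/
def SupportsDesign [Fintype F] (t : ℕ) (C : Submodule F (ι → F)) (k : ℕ) : Prop :=
  ∃ lam : ℕ, ∀ T : Finset ι, T.card = t →
    Nat.card {c : C // wt (c : ι → F) = k ∧ ∀ i ∈ T, (c : ι → F) i ≠ 0} =
      (Fintype.card F - 1) * lam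

/-- `(P, B)` is a `t`-`(v, k, lam)` design (with `v = Fintype.card P`). -/
def IsBlockDesign (t k lam : ℕ) {P : Type*} [Fintype P] [DecidableEq P]
    (B : Multiset (Finset P)) : Prop :=
  (∀ b ∈ B, b.card = k) ∧
  ∀ T : Finset P, T.card = t → B.countP (fun b => T ⊆ b) = lam

open Classical in
theorem design_down {α ι : Type*} [Fintype ι] (A : Finset α) (B : α → Finset ι) (k : ℕ)
    (hB : ∀ a ∈ A, #(B a) = k) (s : ℕ) (hs : s < k)
    (h : ∃ L, ∀ U : Finset ι, #U = s + 1 → #{a ∈ A | U ⊆ B a} = L) :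
    ∃ L, ∀ U : Finset ι, #U = s → #{a ∈ A | U ⊆ B a} = L := by
  obtain ⟨L, hL⟩ := h
  have key : ∀ U : Finset ι, #U = s →
      #{a ∈ A | U ⊆ B a} * (k - s) = (Fintype.card ι - s) * L := by
    intro U hU
    have h1 : ∑ x ∈ Uᶜ, #{a ∈ A | insert x U ⊆ B a} = (Fintype.card ι - s) * L := by
      rw [Finset.sum_congr rfl (g := fun _ => L), Finset.sum_const, Finset.card_compl, hU,
        smul_eq_mul]
      intro x hx
      apply hL
      rw [Finset.card_insert_of_notMem (by simpa using hx), hU]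
    rw [← h1]
    have h2 : ∀ x ∈ Uᶜ, #{a ∈ A | insert x U ⊆ B a} =
        #(Finset.bipartiteAbove (fun x a => x ∈ B a) {a ∈ A | U ⊆ B a} x) := by
      intro x hx
      congr 1
      ext a
      simp [Finset.bipartiteAbove, Finset.insert_subset_iff]
      tauto
    rw [Finset.sum_congr rfl h2, Finset.sum_card_bipartiteAbove_eq_sum_card_bipartiteBelow,
      Finset.sum_congr rfl (g := fun _ => k - s), Finset.sum_const, smul_eq_mul]
    intro a ha
    rw [Finset.mem_filter] at ha
    rw [← hB a ha.1, ← hU, ← Finset.card_sdiff_of_subset ha.2]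
    congr 1
    ext x
    simp [Finset.bipartiteBelow]
    tauto
  refine ⟨(Fintype.card ι - s) * L / (k - s), fun U hU => ?_⟩
  rw [← key U hU, Nat.mul_div_cancel _ (by omega)]

open Classical in
theorem design_down_all {α ι : Type*} [Fintype ι] (A : Finset α) (B : α → Finset ι) (k : ℕ)
    (hB : ∀ a ∈ A, #(B a) = k) (t : ℕ) (ht : t ≤ k)
    (h : ∃ L, ∀ U : Finset ι, #U = t → #{a ∈ A | U ⊆ B a} = L) (s : ℕ) (hs : s ≤ t) :
    ∃ L, ∀ U : Finset ι, #U = s → #{a ∈ A | U ⊆ B a} = L := by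
  induction hs using Nat.decreasingInduction with
  | self => exact h
  | of_succ j hj ih => exact design_down A B k hB j (by omega) ih

open Classical in
theorem design_mixed {α ι : Type*} [Fintype ι] (A : Finset α) (B : α → Finset ι) (k : ℕ)
    (hB : ∀ a ∈ A, #(B a) = k) (t : ℕ) (ht : t ≤ k)
    (h : ∃ L, ∀ U : Finset ι, #U = t → #{a ∈ A | U ⊆ B a} = L) (j : ℕ) :
    ∀ i, i + j ≤ t → ∃ L, ∀ U S : Finset ι, #U = i → #S = j → Disjoint U S →
      #{a ∈ A | U ⊆ B a ∧ Disjoint S (B a)} = L := by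
  induction j with
  | zero =>
    intro i hi
    obtain ⟨L, hL⟩ := design_down_all A B k hB t ht h i (by omega)
    refine ⟨L, fun U S hU hS _ => ?_⟩
    rw [Finset.card_eq_zero] at hS
    subst hS
    simpa using hL U hU
  | succ j ih =>
    intro i hi
    obtain ⟨L1, h1⟩ := ih i (by omega)
    obtain ⟨L2, h2⟩ := ih (i + 1) (by omega)
    refine ⟨L1 - L2, fun U S hU hS hd => ?_⟩
    obtain ⟨x, S', hx, rfl, hS'⟩ := Finset.card_eq_succ.mp hS
    rw [Finset.disjoint_insert_right] at hd
    rw [← h1 U S' hU hS' hd.2, ← h2 (insert x U) S'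
      (by rw [Finset.card_insert_of_notMem hd.1, hU]) hS'
      (by rw [Finset.disjoint_insert_left]; exact ⟨hx, hd.2⟩)]
    apply Nat.eq_sub_of_add_eq
    rw [← Finset.card_filter_add_card_filter_not (s := {a ∈ A | U ⊆ B a ∧ Disjoint S' (B a)})
      (fun a => x ∉ B a), Finset.filter_filter, Finset.filter_filter]
    congr 2 <;> ext a <;>
      simp only [Finset.mem_filter, Finset.disjoint_insert_left, Finset.insert_subset_iff] <;>
      tauto

open Classical in
theorem design_disjoint {α ι : Type*} [Fintype ι] (A : Finset α) (B : α → Finset ι) (k : ℕ)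
    (hB : ∀ a ∈ A, #(B a) = k) (t : ℕ) (ht : t ≤ k)
    (h : ∃ L, ∀ U : Finset ι, #U = t → #{a ∈ A | U ⊆ B a} = L) (T : Finset ι) (hT : #T = t) :
    #{a ∈ A | Disjoint T (B a)} * (Fintype.card ι).choose t =
      #A * (Fintype.card ι - k).choose t := by
  obtain ⟨L, hL⟩ := design_mixed A B k hB t ht h t 0 (by omega)
  have hL' : ∀ S : Finset ι, #S = t → #{a ∈ A | Disjoint S (B a)} = L := by
    intro S hS
    simpa using hL ∅ S rfl hS (by simp)
  rw [hL' T hT]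
  have h1 : ∑ S ∈ Finset.powersetCard t (Finset.univ : Finset ι),
      #(Finset.bipartiteAbove (fun S a => Disjoint S (B a)) A S)
      = L * (Fintype.card ι).choose t := by
    rw [Finset.sum_congr rfl (g := fun _ => L), Finset.sum_const, Finset.card_powersetCard,
      Finset.card_univ, smul_eq_mul, mul_comm]
    intro S hS
    exact hL' S (Finset.mem_powersetCard.mp hS).2
  rw [← h1, Finset.sum_card_bipartiteAbove_eq_sum_card_bipartiteBelow,
    Finset.sum_congr rfl (g := fun _ => (Fintype.card ι - k).choose t), Finset.sum_const,
    smul_eq_mul]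
  intro a ha
  rw [← hB a ha, ← Finset.card_compl, ← Finset.card_powersetCard]
  congr 1
  ext S
  simp [Finset.bipartiteBelow, Finset.mem_powersetCard, Finset.subset_compl_iff_disjoint_right]
  tauto

open Classical in
theorem wt_eq_card {F : Type*} [Field F] {ι : Type*} [Fintype ι] (c : ι → F) :
    wt c = #{i | c i ≠ 0} := by
  rw [wt, Nat.card_eq_fintype_card, Fintype.card_subtype]

open Classical in
theorem wt_restrict {F : Type*} [Field F] {ι : Type*} [Fintype ι] (T : Finset ι) (c : ι → F)
    (hc : ∀ i ∈ T, c i = 0) :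
    wt (LinearMap.funLeft F F (Subtype.val : {i : ι // i ∉ T} → ι) c) = wt c := by
  unfold wt
  refine Nat.card_congr ⟨fun x => ⟨x.1.1, x.2⟩, fun x => ⟨⟨x.1, fun h => x.2 (hc _ h)⟩, x.2⟩,
    fun x => rfl, fun x => rfl⟩

open Classical in
theorem Acount_shortened_eq {F : Type*} [Field F] {ι : Type*} [Fintype ι]
    (C : Submodule F (ι → F)) (T : Finset ι) (k : ℕ) :
    Acount (shortened C T) k =
      Nat.card {c : ι → F // (c ∈ C ∧ wt c = k) ∧ ∀ i ∈ T, c i = 0} := by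
  symm
  unfold Acount
  refine Nat.card_congr (Equiv.ofBijective (fun c => ⟨⟨LinearMap.funLeft F F
    (Subtype.val : {i : ι // i ∉ T} → ι) c.1, Submodule.mem_map_of_mem ⟨c.2.1.1, c.2.2⟩⟩,
    (wt_restrict T c.1 c.2.2).trans c.2.1.2⟩) ⟨?_, ?_⟩)
  · rintro ⟨c, hc, hc'⟩ ⟨e, he, he'⟩ h
    have h' := congrArg (fun x => (x.1.1 : {i : ι // i ∉ T} → F)) h
    apply Subtype.ext
    funext i
    by_cases hi : i ∈ T
    · exact (hc' i hi).trans (he' i hi).symm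
    · exact congrFun h' ⟨i, hi⟩
  · rintro ⟨⟨x, hx⟩, hw⟩
    obtain ⟨c, hc, rfl⟩ := Submodule.mem_map.mp hx
    exact ⟨⟨c, ⟨hc.1, (wt_restrict T c hc.2).symm.trans hw⟩, hc.2⟩, rfl⟩

/-- if the supports of weight-`k` codewords form `t`-designs for all
`d ≤ k ≤ v - t`, then for any `t`-set `T` the weight distribution of the shortened code
is `A_k(C_T) = A_k(C)·C(k,t)·C(v-t,k) / (C(v,t)·C(v-t,k-t))`, independent of `T`. -/
theorem Acount_shortened {F : Type*} [Field F] [Fintype F] {v : ℕ} (d dp t : ℕ)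
    (C : Submodule F (Fin v → F))
    (hd : IsMinDist C d) (hdp : IsMinDist (dualCode C) dp)
    (ht0 : 0 < t) (ht : t < min d dp)
    (hdes : ∀ i : ℕ, d ≤ i → i ≤ v - t → SupportsDesign t C i)
    (T : Finset (Fin v)) (hT : T.card = t)
    (k : ℕ) (hk1 : d ≤ k) (hk2 : k ≤ v - t) :
    Acount (shortened C T) k =
      Acount C k * k.choose t * (v - t).choose k /
        (v.choose t * (v - t).choose (k - t)) := by
  classical
  have hvt : t ≤ v := by
    rw [← hT]; simpa using Finset.card_le_univ T
  have htd : t < d := lt_of_lt_of_le ht (min_le_left _ _)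
  set A : Finset (Fin v → F) := Finset.univ.filter (fun c => c ∈ C ∧ wt c = k) with hA
  set B : (Fin v → F) → Finset (Fin v) := fun c => Finset.univ.filter (fun i => c i ≠ 0) with hBd
  have hB : ∀ a ∈ A, #(B a) = k := by
    intro a ha
    rw [hA, Finset.mem_filter] at ha
    rw [← ha.2.2, wt_eq_card]
  have hdesign : ∃ L, ∀ U : Finset (Fin v), #U = t → #{a ∈ A | U ⊆ B a} = L := by
    obtain ⟨lam, hlam⟩ := hdes k hk1 hk2
    refine ⟨_, fun U hU => (?_ : _ = (Fintype.card F - 1) * lam)⟩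
    rw [← hlam U hU, hA, Finset.filter_filter, ← Fintype.card_subtype, ← Nat.card_eq_fintype_card]
    refine Nat.card_congr ⟨fun x => ⟨⟨x.1, x.2.1.1⟩, x.2.1.2, fun i hi => ?_⟩,
      fun x => ⟨x.1.1, ⟨x.1.2, x.2.1⟩, fun i hi => ?_⟩, fun x => rfl, fun x => rfl⟩
    · simpa [hBd] using x.2.2 hi
    · simpa [hBd] using x.2.2 i hi
  have hmain := design_disjoint A B k hB t (by omega)
    (by convert hdesign) T hT
  have hAc : #A = Acount C k := by
    rw [hA, Acount, ← Fintype.card_subtype, ← Nat.card_eq_fintype_card]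
    exact Nat.card_congr ⟨fun x => ⟨⟨x.1, x.2.1⟩, x.2.2⟩, fun x => ⟨x.1.1, x.1.2, x.2⟩,
      fun x => rfl, fun x => rfl⟩
  have hS : #{a ∈ A | Disjoint T (B a)} = Acount (shortened C T) k := by
    rw [Acount_shortened_eq, hA, Finset.filter_filter, ← Fintype.card_subtype,
      ← Nat.card_eq_fintype_card]
    refine Nat.card_congr (Equiv.subtypeEquivRight fun c => ?_)
    simp [hBd, Finset.disjoint_left]
  have hmain2 : Acount (shortened C T) k * v.choose t = Acount C k * (v - k).choose t := by
    rw [← hS, ← hAc]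
    rw [Fintype.card_fin] at hmain
    convert hmain
  have e1 : v.choose k * k.choose t = v.choose t * (v - t).choose (k - t) :=
    Nat.choose_mul (by omega)
  have e2 : v.choose k * (v - k).choose t = v.choose t * (v - t).choose k := by
    have a1 : v.choose (k + t) * (k + t).choose k = v.choose k * (v - k).choose (k + t - k) :=
      Nat.choose_mul (by omega)
    have a2 : v.choose (k + t) * (k + t).choose t = v.choose t * (v - t).choose (k + t - t) :=
      Nat.choose_mul (by omega)
    rw [Nat.add_sub_cancel_left] at a1
    rw [Nat.add_sub_cancel] at a2
    rw [← a1, ← a2, Nat.choose_symm_add]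
  have p1 : 0 < v.choose t := Nat.choose_pos hvt
  have p2 : 0 < (v - t).choose (k - t) := Nat.choose_pos (by omega)
  symm
  apply Nat.div_eq_of_eq_mul_left (by positivity)
  rw [← e1]
  apply Nat.eq_of_mul_eq_mul_left p1
  calc v.choose t * (Acount C k * k.choose t * (v - t).choose k)
      = Acount C k * k.choose t * (v.choose t * (v - t).choose k) := by ring
    _ = (Acount C k * (v - k).choose t) * (k.choose t * v.choose k) := by rw [← e2]; ring
    _ = _ := by rw [← hmain2]; ring
end

section
/- Let C be a [v, m, d] linear code over GF(q) whose dual has minimum distance d⊥ > t ≥ 1, and suppose the supports of codewords of every weight i with k ≤ i ≤ k+t in C form t-designs (after dividing multiplicities by q-1). Then for any set T of t coordinates, the number of codewords of weight k in the punctured code C^T equals the sum over i = 0, ..., t of [C(v-t, k) · C(k+i, t) · C(t, i) / (C(v-t, k-t+i) · C(v, t))] · A_{k+i}(C), where A_j(C) is the number of codewords of weight j in C; additionally assume t < d so that puncturing on T is injective. -/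
open Finset

variable {F : Type*} [Field F] {ι : Type*} [Fintype ι]

namespace PunctAux

lemma card_super {v : ℕ} (J s : Finset (Fin v)) (hJ : J ⊆ s) (t : ℕ) (ht : J.card ≤ t) :
    #{T ∈ powersetCard t (univ : Finset (Fin v)) | J ⊆ T ∧ T ⊆ s} =
      (s.card - J.card).choose (t - J.card) := by
  rw [← card_sdiff_of_subset hJ, ← card_powersetCard]
  refine card_nbij' (fun T => T \ J) (fun U => U ∪ J) ?_ ?_ ?_ ?_
  · intro T hT
    simp only [coe_filter, mem_powersetCard, Set.mem_ofPred_eq, mem_coe] at hT ⊢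
    refine ⟨sdiff_subset_sdiff hT.2.2 le_rfl, ?_⟩
    rw [card_sdiff_of_subset hT.2.1, hT.1.2]
  · intro U hU
    simp only [coe_filter, mem_powersetCard, Set.mem_ofPred_eq, mem_coe] at hU ⊢
    have hd : Disjoint U J := disjoint_of_subset_left hU.1 sdiff_disjoint
    refine ⟨⟨subset_univ _, ?_⟩, subset_union_right, union_subset (hU.1.trans sdiff_subset) hJ⟩
    rw [card_union_of_disjoint hd, hU.2]; omega
  · intro T hT
    simp only [coe_filter, mem_powersetCard, Set.mem_ofPred_eq, mem_coe] at hT ⊢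
    exact sdiff_union_of_subset hT.2.1
  · intro U hU
    simp only [coe_filter, mem_powersetCard, Set.mem_ofPred_eq, mem_coe] at hU ⊢
    have hd : Disjoint U J := disjoint_of_subset_left hU.1 sdiff_disjoint
    exact union_sdiff_cancel_right hd

lemma card_inter {v : ℕ} (B : Finset (Fin v)) (t i : ℕ) (hi : i ≤ t) :
    #{T ∈ powersetCard t (univ : Finset (Fin v)) | #(B ∩ T) = i} =
      (B.card).choose i * (v - B.card).choose (t - i) := by
  have hc : #Bᶜ = v - #B := by rw [card_compl, Fintype.card_fin]
  rw [← hc, ← card_powersetCard, ← card_powersetCard, ← card_product]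
  have key : ∀ p : Finset (Fin v) × Finset (Fin v), p.1 ⊆ B → p.2 ⊆ Bᶜ →
      Disjoint p.1 p.2 ∧ B ∩ (p.1 ∪ p.2) = p.1 ∧ Bᶜ ∩ (p.1 ∪ p.2) = p.2 := by
    intro p h1 h2
    refine ⟨disjoint_of_subset_left h1 (disjoint_of_subset_right h2 disjoint_compl_right), ?_, ?_⟩
    · ext x
      have := @h1 x
      have := @h2 x
      simp only [mem_inter, mem_union, mem_compl] at *
      tauto
    · ext x
      have := @h1 x
      have := @h2 x
      simp only [mem_inter, mem_union, mem_compl] at *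
      tauto
  have hs : ∀ T : Finset (Fin v), (B ∩ T) ∪ (Bᶜ ∩ T) = T := by
    intro T; ext x; simp only [mem_inter, mem_union, mem_compl]; tauto
  have hdj : ∀ T : Finset (Fin v), Disjoint (B ∩ T) (Bᶜ ∩ T) := fun T =>
    disjoint_of_subset_left inter_subset_left
      (disjoint_of_subset_right inter_subset_left disjoint_compl_right)
  refine card_nbij' (fun T => (B ∩ T, Bᶜ ∩ T)) (fun p => p.1 ∪ p.2) ?_ ?_ ?_ ?_
  · intro T hT
    simp only [coe_filter, mem_powersetCard, Set.mem_ofPred_eq, mem_coe, mem_product] at hT ⊢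
    refine ⟨⟨inter_subset_left, hT.2⟩, inter_subset_left, ?_⟩
    have := card_union_of_disjoint (hdj T)
    rw [hs] at this; omega
  · intro p hp
    simp only [coe_filter, mem_powersetCard, Set.mem_ofPred_eq, mem_coe, mem_product] at hp ⊢
    obtain ⟨h0, h1, h2⟩ := key p hp.1.1 hp.2.1
    refine ⟨⟨subset_univ _, ?_⟩, ?_⟩
    · rw [card_union_of_disjoint h0]; omega
    · rw [h1, hp.1.2]
  · intro T hT
    exact hs T
  · intro p hp
    simp only [mem_powersetCard, mem_coe, mem_product] at hp
    obtain ⟨h0, h1, h2⟩ := key p hp.1.1 hp.2.1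
    exact Prod.ext h1 h2

section design
variable {X : Type*} [Fintype X] {v : ℕ} (B : X → Finset (Fin v)) (w t lam : ℕ)

lemma lam_j (hB : ∀ x, #(B x) = w)
    (hdes : ∀ T : Finset (Fin v), #T = t → #{x | T ⊆ B x} = lam)
    (J : Finset (Fin v)) (hJ : #J ≤ t) :
    #{x | J ⊆ B x} * (w - #J).choose (t - #J) = (v - #J).choose (t - #J) * lam := by
  have h1 := sum_card_bipartiteAbove_eq_sum_card_bipartiteBelow
    (s := ({x | J ⊆ B x} : Finset X))
    (t := ({T ∈ powersetCard t (univ : Finset (Fin v)) | J ⊆ T ∧ T ⊆ univ}))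
    (fun x T => T ⊆ B x)
  rw [sum_const_nat (m := (w - #J).choose (t - #J)), sum_const_nat (m := lam),
    card_super J univ (subset_univ _) t hJ] at h1
  · simpa using h1
  · intro T hT
    simp only [mem_filter, mem_powersetCard] at hT
    rw [← hdes T hT.1.2, bipartiteBelow]
    congr 1
    ext x
    simp only [mem_filter, mem_univ, true_and]
    exact ⟨fun h => h.2, fun h => ⟨hT.2.1.trans h, h⟩⟩
  · intro x hx
    simp only [mem_filter, mem_univ, true_and] at hx
    rw [← hB x, ← card_super J (B x) hx t hJ, bipartiteAbove]
    congr 1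
    ext T
    simp only [mem_filter, subset_univ]
    tauto

lemma sum_choose (hB : ∀ x, #(B x) = w)
    (hdes : ∀ T : Finset (Fin v), #T = t → #{x | T ⊆ B x} = lam)
    (T : Finset (Fin v)) (hT : #T = t) (j : ℕ) (hj : j ≤ t) :
    (∑ x, (#(B x ∩ T)).choose j) * (w - j).choose (t - j) =
      t.choose j * ((v - j).choose (t - j) * lam) := by
  have h1 := sum_card_bipartiteAbove_eq_sum_card_bipartiteBelow
    (s := (univ : Finset X)) (t := powersetCard j T) (fun x J => J ⊆ B x)
  have h2 : ∀ x : X, #(bipartiteAbove (fun x J => J ⊆ B x) (powersetCard j T) x) =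
      (#(B x ∩ T)).choose j := by
    intro x
    rw [← card_powersetCard, bipartiteAbove]
    congr 1
    ext J
    simp only [mem_filter, mem_powersetCard, subset_inter_iff]
    tauto
  simp only [h2] at h1
  rw [h1, sum_mul, sum_const_nat (m := (v - j).choose (t - j) * lam), card_powersetCard, hT]
  intro J hJ
  rw [mem_powersetCard] at hJ
  have := lam_j B w t lam hB hdes J (by omega)
  rw [hJ.2] at this
  exact this

lemma sum_choose_eq (T : Finset (Fin v)) (hT : #T = t) (j : ℕ) :
    (∑ x, (#(B x ∩ T)).choose j) =
      ∑ s ∈ range (t + 1), #{x | #(B x ∩ T) = s} * s.choose j := by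
  rw [← sum_fiberwise_of_maps_to (s := univ) (t := range (t+1)) (g := fun x => #(B x ∩ T))]
  · refine sum_congr rfl fun s _ => ?_
    apply sum_const_nat
    intro x hx
    rw [(mem_filter.1 hx).2]
  · intro x _
    have : #(B x ∩ T) ≤ #T := card_le_card inter_subset_right
    rw [mem_range]; omega

lemma N_const (hw : t ≤ w) (hB : ∀ x, #(B x) = w)
    (hdes : ∀ T : Finset (Fin v), #T = t → #{x | T ⊆ B x} = lam)
    (T T' : Finset (Fin v)) (hT : #T = t) (hT' : #T' = t) (n : ℕ) :
    ∀ i, i ≤ t → t - i = n → #{x | #(B x ∩ T) = i} = #{x | #(B x ∩ T') = i} := by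
  induction n using Nat.strong_induction_on with
  | _ n ih =>
  intro i hi hn
  have h1 := sum_choose B w t lam hB hdes T hT i hi
  have h2 := sum_choose B w t lam hB hdes T' hT' i hi
  have h3 := Nat.eq_of_mul_eq_mul_right (Nat.choose_pos (by omega)) (h1.trans h2.symm)
  rw [sum_choose_eq B t T hT, sum_choose_eq B t T' hT'] at h3
  have hm : i ∈ range (t+1) := by simp; omega
  rw [← add_sum_erase _ _ hm, ← add_sum_erase _ _ hm] at h3
  have h4 : ∑ s ∈ (range (t + 1)).erase i, #{x | #(B x ∩ T) = s} * s.choose i =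
     ∑ s ∈ (range (t + 1)).erase i, #{x | #(B x ∩ T') = s} * s.choose i := by
    refine sum_congr rfl fun s hs => ?_
    rw [mem_erase, mem_range] at hs
    rcases lt_or_ge s i with h | h
    · simp [Nat.choose_eq_zero_of_lt h]
    · rw [ih (t - s) (by omega) s (by omega) rfl]
  rw [h4, Nat.choose_self] at h3
  omega

lemma N_mul (hw : t ≤ w) (hB : ∀ x, #(B x) = w)
    (hdes : ∀ T : Finset (Fin v), #T = t → #{x | T ⊆ B x} = lam)
    (T : Finset (Fin v)) (hT : #T = t) (i : ℕ) (hi : i ≤ t) :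
    v.choose t * #{x | #(B x ∩ T) = i} =
      Fintype.card X * (w.choose i * (v - w).choose (t - i)) := by
  have h1 := sum_card_bipartiteAbove_eq_sum_card_bipartiteBelow
    (s := (univ : Finset X)) (t := powersetCard t (univ : Finset (Fin v)))
    (fun x T => #(B x ∩ T) = i)
  rw [sum_const_nat (m := w.choose i * (v - w).choose (t - i)),
    sum_const_nat (m := #{x | #(B x ∩ T) = i}), card_powersetCard] at h1
  · simpa using h1.symm
  · intro T' hT'
    rw [mem_powersetCard] at hT'
    exact N_const B w t lam hw hB hdes T' T hT'.2 hT _ i hi rfl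
  · intro x _
    rw [← hB x, ← card_inter _ _ _ hi, bipartiteAbove]

end design

lemma binom1 (a b k e : ℕ) :
    (k + e).choose k * (a + b).choose a * ((a + b) + (k + e)).choose (a + b) =
      ((k + a) + (b + e)).choose (k + a) * ((k + a).choose k * (b + e).choose b) := by
  have : ((a + b) + (k + e)) = ((k + a) + (b + e)) := by ring
  apply Nat.cast_injective (R := ℚ)
  push_cast
  have f : ∀ n : ℕ, (n.factorial : ℚ) ≠ 0 := fun n => by exact_mod_cast n.factorial_ne_zero
  have := f a; have := f b; have := f k; have := f e
  have := f (a+b); have := f (k+e); have := f (k+a); have := f (b+e)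
  rw [Nat.cast_add_choose, Nat.cast_add_choose, Nat.cast_add_choose, Nat.cast_add_choose,
    Nat.cast_add_choose, Nat.cast_add_choose]
  rw [show ((a + b) + (k + e)) = ((k + a) + (b + e)) by ring]
  field_simp

lemma binom (v t k i : ℕ) (hi : i ≤ t) (htv : t ≤ v) (hk : k ≤ v - t) (hw : t ≤ k + i) :
    (k + i).choose i * (v - (k + i)).choose (t - i) * (v - t).choose (k + i - t) =
      (v - t).choose k * (k + i).choose t * t.choose i := by
  obtain ⟨b, rfl⟩ := Nat.exists_eq_add_of_le hi
  obtain ⟨e, he⟩ := Nat.exists_eq_add_of_le hk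
  have hv : v = (i + b) + (k + e) := by omega
  have h1 := binom1 i b k e
  have h2 := Nat.choose_mul (n := v) (k := k + i) (s := i + b) hw
  rw [show (k + i) + (b + e) = v by omega, ← hv, ← he] at h1
  rw [show v - (k + i) = b + e by omega, show i + b - i = b by omega]
  rw [show (k+i).choose k = (k+i).choose i from Nat.choose_symm_add] at h1
  apply Nat.eq_of_mul_eq_mul_right (Nat.choose_pos htv)
  calc (k + i).choose i * (b + e).choose b * (v - (i + b)).choose (k + i - (i + b)) *
          v.choose (i + b)
      = (k + i).choose i * (b + e).choose b *
          (v.choose (i + b) * (v - (i + b)).choose (k + i - (i + b))) := by ring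
    _ = v.choose (k + i) * ((k + i).choose i * (b + e).choose b) * (k + i).choose (i + b) := by
        rw [← h2]; ring
    _ = _ := by rw [← h1]; ring

noncomputable def supp {F : Type*} [Field F] {v : ℕ} (c : Fin v → F) : Finset (Fin v) := by
  classical exact {i | c i ≠ 0}

lemma mem_supp {F : Type*} [Field F] {v : ℕ} (c : Fin v → F) (i : Fin v) :
    i ∈ supp c ↔ c i ≠ 0 := by simp [supp]

lemma wt_eq {F : Type*} [Field F] {v : ℕ} (c : Fin v → F) : wt c = #(supp c) := by
  classical
  rw [wt, Nat.card_eq_fintype_card]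
  exact Fintype.card_of_subtype _ (mem_supp c)

lemma wt_punct {F : Type*} [Field F] {v : ℕ} (c : Fin v → F) (T : Finset (Fin v)) :
    wt (LinearMap.funLeft F F (Subtype.val : {i : Fin v // i ∉ T} → Fin v) c) =
      #(supp c \ T) := by
  classical
  rw [wt, ← Fintype.card_coe, ← Nat.card_eq_fintype_card]
  refine Nat.card_congr ⟨fun x => ⟨x.1.1, ?_⟩, fun x => ⟨⟨x.1, ?_⟩, ?_⟩, ?_, ?_⟩
  · exact mem_sdiff.2 ⟨(mem_supp _ _).2 x.2, x.1.2⟩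
  · exact (mem_sdiff.1 x.2).2
  · exact (mem_supp _ _).1 (mem_sdiff.1 x.2).1
  · intro x; rfl
  · intro x; rfl

lemma Acount_punct {F : Type*} [Field F] [Fintype F] {v : ℕ} (d t k : ℕ)
    (C : Submodule F (Fin v → F)) (hd : ∀ c ∈ C, c ≠ 0 → d ≤ wt c) (htd : t < d)
    (T : Finset (Fin v)) (hT : #T = t) :
    Acount (punctured C T) k = Nat.card {c : C // #(supp (c : Fin v → F) \ T) = k} := by
  classical
  set π := LinearMap.funLeft F F (Subtype.val : {i : Fin v // i ∉ T} → Fin v)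
  have hinj : ∀ c ∈ C, π c = 0 → c = 0 := by
    intro c hc h0
    by_contra hne
    have h1 := hd c hc hne
    rw [wt_eq] at h1
    have h2 : supp c ⊆ T := by
      intro i hi
      by_contra hiT
      exact (mem_supp _ _).1 hi (congrFun h0 ⟨i, hiT⟩)
    have := card_le_card h2
    omega
  symm
  refine Nat.card_congr (Equiv.ofBijective
    (fun c => ⟨⟨π c.1.1, Submodule.mem_map_of_mem c.1.2⟩, (wt_punct c.1.1 T).trans c.2⟩) ⟨?_, ?_⟩)
  · intro a b hab
    have hab' : π a.1.1 = π b.1.1 := congrArg (fun z => z.1.1) hab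
    have := hinj (a.1.1 - b.1.1) (C.sub_mem a.1.2 b.1.2) (by rw [map_sub, hab', sub_self])
    exact Subtype.ext (Subtype.ext (sub_eq_zero.1 this))
  · rintro ⟨⟨y, hy⟩, hyk⟩
    obtain ⟨c, hc, rfl⟩ := hy
    exact ⟨⟨⟨c, hc⟩, (wt_punct c T).symm.trans hyk⟩, rfl⟩

lemma term_eq {F : Type*} [Field F] [Fintype F] {v : ℕ} (d t k : ℕ)
    (C : Submodule F (Fin v → F)) (hd : ∀ c ∈ C, c ≠ 0 → d ≤ wt c) (htd : t < d)
    (hk1 : 1 ≤ k) (hk2 : k ≤ v - t)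
    (T : Finset (Fin v)) (hT : #T = t) (i : ℕ) (hi : i ≤ t)
    (hdes : SupportsDesign t C (k + i)) :
    Nat.card {c : C // wt (c : Fin v → F) = k + i ∧ #(supp (c : Fin v → F) ∩ T) = i} =
      (v - t).choose k * (k + i).choose t * t.choose i * Acount C (k + i) /
          ((v - t).choose (k + i - t) * v.choose t) := by
  classical
  have htv : t ≤ v := by
    have := card_le_univ T
    rw [Fintype.card_fin] at this; omega
  rcases lt_or_ge (k + i) t with hw | hw
  · rw [Nat.choose_eq_zero_of_lt hw]
    simp only [mul_zero, zero_mul, Nat.zero_div]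
    have : IsEmpty {c : C // wt (c : Fin v → F) = k + i ∧ #(supp (c : Fin v → F) ∩ T) = i} := by
      refine ⟨fun ⟨c, hc, _⟩ => ?_⟩
      by_cases h0 : (c : Fin v → F) = 0
      · rw [h0, wt_eq] at hc
        have : supp (0 : Fin v → F) = ∅ := by ext; simp [mem_supp]
        rw [this, card_empty] at hc; omega
      · have := hd c c.2 h0
        omega
    exact Nat.card_of_isEmpty
  · obtain ⟨lam, hlam⟩ := hdes
    let X := {c : C // wt (c : Fin v → F) = k + i}
    haveI : Fintype X := Fintype.ofFinite X
    have hN := N_mul (X := X) (fun c => supp (c.1 : Fin v → F)) (k + i) t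
      ((Fintype.card F - 1) * lam) hw (fun c => (wt_eq _).symm.trans c.2) (by
        intro T' hT'
        rw [← hlam T' hT', ← Fintype.card_subtype, ← Nat.card_eq_fintype_card]
        refine Nat.card_congr ((Equiv.subtypeSubtypeEquivSubtypeInter _
          (fun c : C => T' ⊆ supp (c : Fin v → F))).trans (Equiv.subtypeEquivRight ?_))
        intro c
        simp only [subset_iff, mem_supp]) T hT i hi
    have hX : Fintype.card X = Acount C (k + i) := by
      rw [← Nat.card_eq_fintype_card]; rfl
    have hL : #{x : X | #(supp (x.1 : Fin v → F) ∩ T) = i} =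
        Nat.card {c : C // wt (c : Fin v → F) = k + i ∧ #(supp (c : Fin v → F) ∩ T) = i} := by
      rw [← Fintype.card_subtype, ← Nat.card_eq_fintype_card]
      exact Nat.card_congr (Equiv.subtypeSubtypeEquivSubtypeInter _
          (fun c : C => #(supp (c : Fin v → F) ∩ T) = i))
    rw [hX, hL] at hN
    symm
    apply Nat.div_eq_of_eq_mul_left
    · exact Nat.mul_pos (Nat.choose_pos (by omega)) (Nat.choose_pos htv)
    · rw [← binom v t k i hi htv hk2 hw]
      generalize Nat.card _ = N at hN ⊢
      calc _ = (v - t).choose (k + i - t) *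
            (Acount C (k + i) * ((k + i).choose i * (v - (k + i)).choose (t - i))) := by ring
        _ = _ := by rw [← hN]; ring

end PunctAux

/-- if the supports of codewords of every weight `i` with `k ≤ i ≤ k + t`
form `t`-designs, then for any `t`-set `T`,
`A_k(C^T) = ∑_{i=0}^{t} [C(v-t,k)·C(k+i,t)·C(t,i)/(C(v-t,k+i-t)·C(v,t))] · A_{k+i}(C)`. -/
theorem Acount_punctured {F : Type*} [Field F] [Fintype F] {v : ℕ} (d dp t k : ℕ)
    (C : Submodule F (Fin v → F))
    (hd : IsMinDist C d) (hdp : IsMinDist (dualCode C) dp)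
    (ht0 : 1 ≤ t) (htdp : t < dp) (htd : t < d)
    (hk1 : 1 ≤ k) (hk2 : k ≤ v - t)
    (hdes : ∀ i : ℕ, k ≤ i → i ≤ k + t → SupportsDesign t C i)
    (T : Finset (Fin v)) (hT : T.card = t) :
    Acount (punctured C T) k =
      ∑ i ∈ Finset.range (t + 1),
        (v - t).choose k * (k + i).choose t * t.choose i * Acount C (k + i) /
          ((v - t).choose (k + i - t) * v.choose t) := by 
  classical
  rw [PunctAux.Acount_punct d t k C hd.2 htd T hT]
  haveI : Fintype C := Fintype.ofFinite C
  rw [Nat.card_eq_fintype_card, Fintype.card_subtype,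
    card_eq_sum_card_fiberwise (f := fun c : C => #(PunctAux.supp (c : Fin v → F) ∩ T))
      (t := Finset.range (t + 1))]
  · refine sum_congr rfl fun i hi => ?_
    rw [mem_range] at hi
    rw [← PunctAux.term_eq d t k C hd.2 htd hk1 hk2 T hT i (by omega)
      (hdes (k + i) (by omega) (by omega)), Nat.card_eq_fintype_card, Fintype.card_subtype,
      filter_filter]
    congr 1
    ext c
    simp only [mem_filter, mem_univ, true_and, PunctAux.wt_eq]
    have := card_sdiff_add_card_inter (PunctAux.supp (c : Fin v → F)) T
    omega
  · intro c _
    have : #(PunctAux.supp (c : Fin v → F) ∩ T) ≤ #T := card_le_card inter_subset_right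
    simp only [coe_range, Set.mem_Iio]
    omega
end

section
/- Let C be a linear code over GF(q) of length v and minimum weight d. If w is an integer with w ≤ v satisfying w - ⌊(w + q - 2)/(q - 1)⌋ < d, then for any k with d ≤ k ≤ w, no two distinct codewords of weight k in C that are not scalar multiples of each other have the same support. -/
open Finset

variable {F : Type*} [Field F] {ι : Type*} [Fintype ι]

/-- if `w ≤ v` satisfies `w - ⌊(w+q-2)/(q-1)⌋ < d`, then for `d ≤ k ≤ w`
any two weight-`k` codewords with the same support are scalar multiples of each other. -/
theorem same_support_scalar {F : Type*} [Field F] [Fintype F] {v : ℕ} (q d w : ℕ)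
    (hq : Fintype.card F = q)
    (C : Submodule F (Fin v → F)) (hd : IsMinDist C d)
    (hwv : w ≤ v) (hcond : w - (w + q - 2) / (q - 1) < d)
    (k : ℕ) (hdk : d ≤ k) (hkw : k ≤ w)
    (c1 c2 : Fin v → F) (h1 : c1 ∈ C) (h2 : c2 ∈ C)
    (hw1 : wt c1 = k) (hw2 : wt c2 = k)
    (hsupp : ∀ i, c1 i = 0 ↔ c2 i = 0) :
    ∃ a : F, a ≠ 0 ∧ c2 = a • c1 := by
  classical
  by_contra hno
  push Not at hno
  have hwt : ∀ c : Fin v → F, wt c = (univ.filter (fun i => c i ≠ 0)).card := by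
    intro c
    unfold wt
    rw [Nat.card_eq_fintype_card, Fintype.card_subtype]
  obtain ⟨m, hm⟩ : ∃ m, q = m + 2 := by
    have : 1 < Fintype.card F := Fintype.one_lt_card
    exact ⟨q - 2, by omega⟩
  set S := univ.filter (fun i => c1 i ≠ 0) with hS
  have hSk : S.card = k := by rw [← hw1, hwt]
  have hmaps : Set.MapsTo (fun i => c2 i / c1 i) (S : Set (Fin v))
      ((univ.erase (0 : F) : Finset F) : Set F) := by
    intro i hi
    have hi' : c1 i ≠ 0 := by simpa [hS] using hi
    have h2' : c2 i ≠ 0 := fun h => hi' ((hsupp i).2 h)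
    simp [hi', h2']
  have hsum := Finset.card_eq_sum_card_fiberwise hmaps
  have hfib : ∀ a ∈ (univ.erase (0 : F) : Finset F),
      (S.filter (fun i => c2 i / c1 i = a)).card ≤ k - d := by
    intro a ha
    have ha0 : a ≠ 0 := by simpa using ha
    have hne : c2 - a • c1 ≠ 0 := fun h => hno a ha0 (sub_eq_zero.1 h)
    have hle := hd.2 _ (C.sub_mem h2 (C.smul_mem a h1)) hne
    rw [hwt] at hle
    have hsub : univ.filter (fun i => (c2 - a • c1) i ≠ 0) ⊆
        S.filter (fun i => ¬ c2 i / c1 i = a) := by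
      intro i hi
      simp only [mem_filter, mem_univ, true_and, Pi.sub_apply, Pi.smul_apply, smul_eq_mul,
        hS] at hi ⊢
      have hc : c1 i ≠ 0 := by
        intro h
        apply hi
        rw [(hsupp i).1 h, h]
        simp
      refine ⟨hc, fun h => hi ?_⟩
      rw [div_eq_iff hc] at h
      rw [h, sub_self]
    have h3 := Finset.card_le_card hsub
    have h4 := Finset.card_filter_add_card_filter_not (s := S) (fun i => c2 i / c1 i = a)
    omega
  have hk : k ≤ (m + 1) * (k - d) := by
    have h5 := Finset.sum_le_card_nsmul _ _ _ hfib
    rw [← hsum, hSk, Finset.card_erase_of_mem (mem_univ _), Finset.card_univ, hq, hm] at h5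
    simpa using h5
  subst hm
  have e1 : w + (m + 2) - 2 = w + m := by omega
  have e2 : m + 2 - 1 = m + 1 := by omega
  rw [e1, e2] at hcond
  have h6 : w - d + 1 ≤ (w + m) / (m + 1) := by omega
  rw [Nat.le_div_iff_mul_le (by omega)] at h6
  obtain ⟨e, rfl⟩ := Nat.exists_eq_add_of_le hdk
  obtain ⟨f, rfl⟩ := Nat.exists_eq_add_of_le hkw
  have e3 : d + e - d = e := by omega
  have e4 : d + e + f - d = e + f := by omega
  rw [e3] at hk
  rw [e4] at h6
  nlinarith [Nat.zero_le (m * f)]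
end

section
/- Let f be a bent function from GF(2^n) to GF(2) with n ≥ 6 even, with support D_f of size ν_f, and let C(D_f) be the binary code {(Tr(x d) + y)_{d ∈ D_f} : x ∈ GF(2^n), y ∈ GF(2)}, which is a [ν_f, n+1] code with nonzero weights ν_f/2 - 2^{(n-4)/2}, ν_f/2 + 2^{(n-4)/2}, ν_f, with multiplicities 2^n - 1, 2^n - 1, 1 respectively, supporting 2-designs. Then for any single coordinate position t1, the shortened code C(D_f)_{t1} has length ν_f - 1, dimension n, and exactly two nonzero weights: weight ν_f/2 - 2^{(n-4)/2} with multiplicity (ν_f + 2^{(n-2)/2})(2^n - 1)/(2ν_f) and weight ν_f/2 + 2^{(n-4)/2} with multiplicity (ν_f - 2^{(n-2)/2})(2^n - 1)/(2ν_f). -/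
open Finset

variable {F : Type*} [Field F] {ι : Type*} [Fintype ι]

/-- The additive character `(-1)^y` of `ZMod 2` with values in `ℤ`. -/
def chi : ZMod 2 → ℤ := fun y => if y = 0 then 1 else -1


lemma chi_add (a b : ZMod 2) : chi (a + b) = chi a * chi b := by
  revert a b; decide

lemma chi_pm (a : ZMod 2) : chi a = 1 ∨ chi a = -1 := by
  revert a; decide

lemma sum_chi_wt {J : Type*} [Fintype J] (c : J → ZMod 2) :
    ∑ i, chi (c i) = (Nat.card J : ℤ) - 2 * (wt c : ℤ) := by
  classical
  have h : ∀ a : ZMod 2, chi a = 1 - 2 * (if a ≠ 0 then 1 else 0) := by decide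
  simp_rw [h]
  rw [Finset.sum_sub_distrib, ← Finset.mul_sum]
  rw [← Finset.sum_filter_add_sum_filter_not Finset.univ (fun i => c i ≠ 0)
    (fun i => if c i ≠ 0 then (1 : ℤ) else 0), Finset.sum_ite_of_true (by simp),
    Finset.sum_ite_of_false (by simp)]
  simp [wt, Fintype.card_subtype]

lemma sum_chi_trace (K : Type*) [Field K] [Fintype K] [Algebra (ZMod 2) K] (b : K) (hb : b ≠ 0) :
    ∑ x : K, chi (Algebra.trace (ZMod 2) K (b * x)) = 0 := by
  classical
  have : FiniteDimensional (ZMod 2) K := Module.Finite.of_finite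
  obtain ⟨x0, hx0⟩ : ∃ x0, Algebra.trace (ZMod 2) K (b * x0) ≠ 0 := by
    by_contra! h
    apply hb
    exact (traceForm_nondegenerate (ZMod 2) K).1 b (fun y => by
      simpa [Algebra.traceForm_apply] using h y)
  have h1 : chi (Algebra.trace (ZMod 2) K (b * x0)) = -1 := by
    unfold chi; rw [if_neg hx0]
  have h2 := Equiv.sum_comp (Equiv.addRight x0) (fun x => chi (Algebra.trace (ZMod 2) K (b * x)))
  simp only [Equiv.coe_addRight, mul_add, map_add, chi_add, h1] at h2
  rw [← Finset.sum_mul] at h2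
  linarith

/-- The parametrisation of the shortened code. -/
noncomputable def Lmap {K : Type*} [Field K] [Algebra (ZMod 2) K] {f : K → ZMod 2}
    (t1 : {d : K // f d = 1}) (J : Type*) (g : J → {d : K // f d = 1}) :
    K →ₗ[ZMod 2] (J → ZMod 2) where
  toFun x := fun i => Algebra.trace (ZMod 2) K (x * ((g i).1 - t1.1))
  map_add' x y := by ext i; simp [add_mul]
  map_smul' a x := by ext i; simp

lemma shortened_eq {K : Type*} [Field K] [Fintype K] [Algebra (ZMod 2) K] {f : K → ZMod 2}
    (t1 : {d : K // f d = 1})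
    (CD : Submodule (ZMod 2) ({d : K // f d = 1} → ZMod 2))
    (hCD : CD = Submodule.span (ZMod 2) (Set.range fun p : K × ZMod 2 =>
      fun d : {d : K // f d = 1} => Algebra.trace (ZMod 2) K (p.1 * d.1) + p.2)) :
    shortened CD {t1} = LinearMap.range (Lmap t1
      {i : {d : K // f d = 1} // i ∉ ({t1} : Finset {d : K // f d = 1})} Subtype.val) := by
  have hmem : ∀ c, c ∈ CD ↔ ∃ p : K × ZMod 2,
      c = fun d => Algebra.trace (ZMod 2) K (p.1 * d.1) + p.2 := by
    intro c
    rw [hCD]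
    constructor
    · intro hc
      induction hc using Submodule.span_induction with
      | mem x h => obtain ⟨p, rfl⟩ := h; exact ⟨p, rfl⟩
      | zero => exact ⟨0, by ext; simp⟩
      | add x y _ _ hx hy =>
        obtain ⟨p, rfl⟩ := hx
        obtain ⟨q, rfl⟩ := hy
        exact ⟨p + q, by ext d; simp [add_mul]; ring⟩
      | smul a x _ hx =>
        obtain ⟨p, rfl⟩ := hx
        exact ⟨a • p, by ext d; simp [mul_add]⟩
    · rintro ⟨p, rfl⟩
      exact Submodule.subset_span ⟨p, rfl⟩
  ext v
  simp only [shortened, punctured, Submodule.mem_map, Submodule.mem_inf, LinearMap.mem_range]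
  constructor
  · rintro ⟨c, ⟨hc, hv⟩, rfl⟩
    obtain ⟨p, rfl⟩ := (hmem c).1 hc
    have h0 : Algebra.trace (ZMod 2) K (p.1 * t1.1) + p.2 = 0 := hv t1 (by simp)
    refine ⟨p.1, ?_⟩
    ext i
    simp only [Lmap, LinearMap.coe_mk, AddHom.coe_mk, LinearMap.funLeft_apply, mul_sub, map_sub]
    have h2 : ∀ a b c : ZMod 2, b + c = 0 → a - b = a + c := by decide
    exact h2 _ _ _ h0
  · rintro ⟨x, rfl⟩
    refine ⟨fun d => Algebra.trace (ZMod 2) K (x * d.1) + -Algebra.trace (ZMod 2) K (x * t1.1),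
      ⟨(hmem _).2 ⟨(x, _), rfl⟩, ?_⟩, ?_⟩
    · intro i hi
      simp only [Finset.mem_singleton] at hi
      subst hi
      exact add_neg_cancel _
    · ext i
      simp only [Lmap, LinearMap.coe_mk, AddHom.coe_mk, LinearMap.funLeft_apply, mul_sub, map_sub]
      exact (sub_eq_add_neg _ _).symm

theorem shortened_bent_code (n : ℕ) (hn : 6 ≤ n) (hpar : Even n)
    (K : Type*) [Field K] [Fintype K] [Algebra (ZMod 2) K]
    (hK : Fintype.card K = 2 ^ n)
    (f : K → ZMod 2)
    (hbent : ∀ b : K,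
      (∑ x : K, chi (f x + Algebra.trace (ZMod 2) K (b * x))) = 2 ^ (n / 2) ∨
      (∑ x : K, chi (f x + Algebra.trace (ZMod 2) K (b * x))) = -(2 ^ (n / 2)))
    (ν : ℕ) (hν : ν = Nat.card {d : K // f d = 1})
    (CD : Submodule (ZMod 2) ({d : K // f d = 1} → ZMod 2))
    (hCD : CD = Submodule.span (ZMod 2) (Set.range fun p : K × ZMod 2 =>
      fun d : {d : K // f d = 1} => Algebra.trace (ZMod 2) K (p.1 * d.1) + p.2))
    (t1 : {d : K // f d = 1}) :
    Nat.card {i : {d : K // f d = 1} // i ∉ ({t1} : Finset {d : K // f d = 1})} = ν - 1 ∧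
    Module.finrank (ZMod 2) (shortened CD {t1}) = n ∧
    Acount (shortened CD {t1}) (ν / 2 - 2 ^ ((n - 4) / 2)) =
      (ν + 2 ^ ((n - 2) / 2)) * (2 ^ n - 1) / (2 * ν) ∧
    Acount (shortened CD {t1}) (ν / 2 + 2 ^ ((n - 4) / 2)) =
      (ν - 2 ^ ((n - 2) / 2)) * (2 ^ n - 1) / (2 * ν) ∧
    ∀ k : ℕ, k ≠ 0 → k ≠ ν / 2 - 2 ^ ((n - 4) / 2) → k ≠ ν / 2 + 2 ^ ((n - 4) / 2) →
      Acount (shortened CD {t1}) k = 0 := by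
  classical
  have : FiniteDimensional (ZMod 2) K := Module.Finite.of_finite
  -- powers of two
  obtain ⟨r, hr⟩ : ∃ r, n = 2 * r + 6 := by
    obtain ⟨s, hs⟩ := hpar
    exact ⟨s - 3, by omega⟩
  obtain ⟨m, hm⟩ : ∃ m : ℕ, m = 2 ^ (r + 1) := ⟨_, rfl⟩
  have hm2 : 2 ≤ m := by
    rw [hm, pow_succ]; have := Nat.one_le_two_pow (n := r); omega
  have e1 : (2 : ℕ) ^ ((n - 4) / 2) = m := by
    rw [hm]; congr 1; omega
  have e2 : (2 : ℕ) ^ ((n - 2) / 2) = 2 * m := by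
    rw [hm, show (n - 2) / 2 = (r + 1) + 1 by omega]; ring
  have e3 : (2 : ℤ) ^ (n / 2) = 4 * m := by
    rw [hm, show n / 2 = (r + 1) + 2 by omega]; push_cast; ring
  have e4 : (2 : ℕ) ^ n = 16 * m ^ 2 := by
    rw [hm, hr]; ring
  -- shortened code as a range
  have hS := shortened_eq t1 CD hCD
  set J := {i : {d : K // f d = 1} // i ∉ ({t1} : Finset {d : K // f d = 1})} with hJ
  set L : K →ₗ[ZMod 2] (J → ZMod 2) := Lmap t1 J Subtype.val with hL
  have hLapp : ∀ x i, L x i = Algebra.trace (ZMod 2) K (x * (i.1.1 - t1.1)) := fun _ _ => rfl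
  have hν1 : 1 ≤ ν := by
    rw [hν]; exact Nat.card_pos_iff.2 ⟨⟨t1⟩, inferInstance⟩
  have hlen : Nat.card J = ν - 1 := by
    rw [hν, Nat.card_eq_fintype_card, Nat.card_eq_fintype_card, Fintype.card_subtype_compl]
    simp
  -- sums over D
  have hD : ∀ x : K, ∑ d : {d : K // f d = 1}, chi (Algebra.trace (ZMod 2) K (x * d.1)) * 2 =
      ∑ y : K, chi (Algebra.trace (ZMod 2) K (x * y)) -
      ∑ y : K, chi (f y + Algebra.trace (ZMod 2) K (x * y)) := by
    intro x
    rw [← Finset.sum_sub_distrib]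
    have hk : ∀ a b : ZMod 2, chi b - chi (a + b) = if a = 1 then chi b * 2 else 0 := by decide
    simp_rw [hk]
    rw [← Finset.sum_filter]
    exact (Finset.sum_subtype (Finset.univ.filter fun y => f y = 1) (by simp)
      (fun y => chi (Algebra.trace (ZMod 2) K (x * y)) * 2)).symm
  have hν2 : ∃ ε : ℤ, (ε = 1 ∨ ε = -1) ∧ (ν : ℤ) = 8 * m ^ 2 - 2 * ε * m := by
    have h0 := hD 0
    have hb := hbent 0
    simp only [zero_mul, map_zero] at h0 hb
    have hc0 : chi 0 = 1 := by decide
    rw [e3] at hb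
    simp only [hc0] at h0
    simp only [Finset.sum_const, Finset.card_univ, hK, ← Nat.card_eq_fintype_card,
      ← hν, nsmul_eq_mul] at h0
    rw [e4] at h0
    push_cast at h0
    rcases hb with hb | hb
    · exact ⟨1, Or.inl rfl, by rw [hb] at h0; linarith⟩
    · exact ⟨-1, Or.inr rfl, by rw [hb] at h0; linarith⟩
  obtain ⟨ε, hε, hνε⟩ := hν2
  have hsplit : ∀ g : {d : K // f d = 1} → ℤ, ∑ d, g d = ∑ i : J, g i.1 + g t1 := by
    intro g
    rw [← Finset.sum_erase_add _ _ (Finset.mem_univ t1)]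
    congr 1
    exact Finset.sum_subtype _ (by simp) g
  have hu : ∀ x, x ≠ 0 → (ν : ℤ) - 2 * wt (L x) = 2 * m ∨ (ν : ℤ) - 2 * wt (L x) = -(2 * m) := by
    intro x hx
    have h1 := sum_chi_wt (L x)
    have h2 := hsplit (fun d => chi (Algebra.trace (ZMod 2) K (x * (d.1 - t1.1))))
    have h3 : ∀ d : {d : K // f d = 1}, chi (Algebra.trace (ZMod 2) K (x * (d.1 - t1.1))) =
        chi (Algebra.trace (ZMod 2) K (x * d.1)) * chi (Algebra.trace (ZMod 2) K (x * t1.1)) := by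
      intro d
      have : ∀ a b : ZMod 2, chi (a - b) = chi a * chi b := by decide
      rw [mul_sub, map_sub, this]
    have h4 := hD x
    rw [sum_chi_trace K x hx, ← Finset.sum_mul] at h4
    have hb := hbent x
    rw [e3] at hb
    have hc0 : chi 0 = 1 := by decide
    simp only [sub_self, mul_zero, map_zero, hc0] at h2
    rw [Finset.sum_congr rfl (fun d _ => h3 d), ← Finset.sum_mul] at h2
    simp only [hLapp] at h1
    rw [h1, hlen] at h2
    push_cast [Nat.cast_sub hν1] at h2
    rcases chi_pm (Algebra.trace (ZMod 2) K (x * t1.1)) with hc | hc <;>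
    rcases hb with hb | hb <;> rw [hc] at h2 <;> rw [hb] at h4
    · right; linarith
    · left; linarith
    · left; linarith
    · right; linarith
  have hwt0 : wt (L 0) = 0 := by simp [wt]
  have htot : ∑ x : K, ((ν : ℤ) - 2 * wt (L x)) = 16 * m ^ 2 := by
    have h1 : ∀ x, (ν : ℤ) - 2 * wt (L x) = ∑ i, chi (L x i) + 1 := by
      intro x
      rw [sum_chi_wt, hlen]; push_cast [Nat.cast_sub hν1]; ring
    simp_rw [h1]
    rw [Finset.sum_add_distrib, Finset.sum_comm]
    have h2 : ∀ i : J, ∑ x, chi (L x i) = 0 := by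
      intro i
      have hne : i.1.1 - t1.1 ≠ 0 := by
        intro h
        apply i.2
        rw [Finset.mem_singleton]
        exact Subtype.ext (sub_eq_zero.1 h)
      rw [← sum_chi_trace K _ hne]
      exact Finset.sum_congr rfl (fun x _ => by rw [hLapp, mul_comm])
    simp [h2, hK, e4]
  obtain ⟨h, hh⟩ : ∃ h : ℕ, ν = 2 * h ∧ m < h ∧ (h : ℤ) = 4 * m ^ 2 - ε * m := by
    have hε' : 0 ≤ 4 * (m : ℤ) - ε := by rcases hε with h | h <;> rw [h] <;> omega
    obtain ⟨k, hk⟩ := Int.eq_ofNat_of_zero_le hε'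
    have hkm : ((m * k : ℕ) : ℤ) = 4 * m ^ 2 - ε * m := by push_cast; rw [← hk]; ring
    refine ⟨m * k, ?_, ?_, hkm⟩
    · zify; push_cast at hkm; linarith
    · have : 2 ≤ k := by rcases hε with h | h <;> rw [h] at hk <;> omega
      nlinarith
  obtain ⟨hνh, hmh, hhε⟩ := hh
  have hu' : ∀ x, x ≠ 0 → wt (L x) = h - m ∨ wt (L x) = h + m := by
    intro x hx
    rcases hu x hx with h1 | h1
    · left; omega
    · right; omega
  have hinj : Function.Injective L := by
    rw [← LinearMap.ker_eq_bot, LinearMap.ker_eq_bot']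
    intro x hx
    by_contra hne
    have := hu' x hne
    rw [hx, ← map_zero L, hwt0] at this
    omega
  have hA : ∀ k, Acount (shortened CD {t1}) k = (Finset.univ.filter fun x => wt (L x) = k).card := by
    intro k
    rw [hS, Acount, ← Fintype.card_subtype, ← Nat.card_eq_fintype_card]
    refine (Nat.card_congr ?_).symm
    exact (LinearEquiv.ofInjective L hinj).toEquiv.subtypeEquiv (fun x => by simp)
  set a := (Finset.univ.filter fun x => wt (L x) = h - m).card with ha
  set b := (Finset.univ.filter fun x => wt (L x) = h + m).card with hb
  have hsumg : ∀ g : ℕ → ℤ, ∑ x, g (wt (L x)) = g 0 + a * g (h - m) + b * g (h + m) := by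
    intro g
    have h1 : ∀ x, g (wt (L x)) = (if x = 0 then g 0 else 0) +
        (if wt (L x) = h - m then g (h - m) else 0) +
        (if wt (L x) = h + m then g (h + m) else 0) := by
      intro x
      by_cases hx : x = 0
      · rw [hx, hwt0, if_pos rfl, if_neg (by omega), if_neg (by omega)]; ring
      · rw [if_neg hx]
        rcases hu' x hx with h2 | h2 <;> rw [h2]
        · rw [if_pos rfl, if_neg (by omega)]; ring
        · rw [if_pos rfl, if_neg (by omega)]; ring
    rw [Finset.sum_congr rfl (fun x _ => h1 x), Finset.sum_add_distrib, Finset.sum_add_distrib]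
    simp [← Finset.sum_filter, ha, hb]
  have hcount : (16 : ℤ) * m ^ 2 = 1 + a + b := by
    have := hsumg (fun _ => 1)
    simp only [Finset.sum_const, Finset.card_univ, hK, e4] at this
    push_cast at this
    simpa using this
  have hdiff : ((a : ℤ) - b) = 4 * m + ε := by
    have h1 := hsumg (fun k => (ν : ℤ) - 2 * k)
    rw [htot] at h1
    push_cast [Nat.cast_sub hmh.le] at h1
    have hmpos : (2 * m : ℤ) ≠ 0 := by positivity
    apply mul_left_cancel₀ hmpos
    rw [hνε, hhε] at h1
    linear_combination -h1
  have hε2 : ε ^ 2 = 1 := by rcases hε with h | h <;> rw [h] <;> norm_num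
  have hq1 : (1 : ℕ) ≤ 16 * m ^ 2 := by nlinarith
  have hν2m : 2 * m ≤ ν := by omega
  rw [hA, hA, e1, e2, e4, show ν / 2 = h by omega, ← ha, ← hb]
  refine ⟨hlen, ?_, ?_, ?_, ?_⟩
  · rw [hS, LinearMap.finrank_range_of_inj hinj]
    have := Module.card_eq_pow_finrank (K := ZMod 2) (V := K)
    rw [hK, ZMod.card] at this
    exact (Nat.pow_right_injective le_rfl this).symm
  · symm
    apply Nat.div_eq_of_eq_mul_left (by omega)
    zify [hq1]
    have h2a : 2 * (a : ℤ) = 16 * m ^ 2 - 1 + 4 * m + ε := by linarith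
    rw [hνε]
    linear_combination (-(8 * (m:ℤ) ^ 2 - 2 * ε * m)) * h2a + (2 * (m : ℤ)) * hε2
  · symm
    apply Nat.div_eq_of_eq_mul_left (by omega)
    zify [hq1, hν2m]
    have h2b : 2 * (b : ℤ) = 16 * m ^ 2 - 1 - 4 * m - ε := by linarith
    rw [hνε]
    linear_combination (-(8 * (m:ℤ) ^ 2 - 2 * ε * m)) * h2b - (2 * (m : ℤ)) * hε2
  · intro k hk0 hk1 hk2
    rw [hA, Finset.card_eq_zero, Finset.filter_eq_empty_iff]
    intro x _ hx
    by_cases hx0 : x = 0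
    · rw [hx0, hwt0] at hx; exact hk0 hx.symm
    · rcases hu' x hx0 with h1 | h1 <;> omega
end

section
/- Let C be a [v, m, d] linear code over GF(q) with dual minimum distance d⊥, and let t be a positive integer with 0 < t < min(d, d⊥). Then the supports of weight-k codewords of C form t-designs for all 0 ≤ k ≤ v if and only if for every 1 ≤ t′ ≤ t and every set T of t′ coordinate positions, the weight distribution of the shortened code C_T is independent of the choice of T. -/
open Finset

variable {F : Type*} [Field F] {ι : Type*} [Fintype ι]

open scoped Classical in
/-- Codewords of weight `k`. -/
noncomputable def auxW [Fintype F] (C : Submodule F (ι → F)) (k : ℕ) : Finset (ι → F) :=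
  Finset.univ.filter fun c => c ∈ C ∧ wt c = k

open scoped Classical in
/-- Number of weight-`k` codewords nonzero on `S`. -/
noncomputable def auxN [Fintype F] (C : Submodule F (ι → F)) (k : ℕ) (S : Finset ι) : ℕ :=
  #{c ∈ auxW C k | ∀ i ∈ S, c i ≠ 0}

open scoped Classical in
/-- Number of weight-`k` codewords zero on `S`. -/
noncomputable def auxZ [Fintype F] (C : Submodule F (ι → F)) (k : ℕ) (S : Finset ι) : ℕ :=
  #{c ∈ auxW C k | ∀ i ∈ S, c i = 0}

open scoped Classical in
theorem aux_incl_excl {Ω α : Type*} (W : Finset Ω) (p : Ω → α → Prop) (T : Finset α) :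
    ((#{c ∈ W | ∀ i ∈ T, ¬ p c i} : ℕ) : ℤ) =
      ∑ S ∈ T.powerset, (-1) ^ #S * ((#{c ∈ W | ∀ i ∈ S, p c i} : ℕ) : ℤ) := by
  have h1 : ∀ (q : Ω → α → Prop) (S : Finset α), ((#{c ∈ W | ∀ i ∈ S, q c i} : ℕ) : ℤ)
      = ∑ c ∈ W, ∏ i ∈ S, (if q c i then (1 : ℤ) else 0) := by
    intro q S
    rw [Finset.card_filter]
    push_cast
    refine Finset.sum_congr rfl fun c _ => ?_
    rw [Finset.prod_ite_zero]
    simp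
  have h2 : ((#{c ∈ W | ∀ i ∈ T, ¬ p c i} : ℕ) : ℤ)
      = ∑ c ∈ W, ∏ i ∈ T, (if ¬ p c i then (1 : ℤ) else 0) := by
    convert h1 (fun c i => ¬ p c i) T
  rw [h2]
  simp_rw [h1 p, Finset.mul_sum]
  rw [Finset.sum_comm]
  refine Finset.sum_congr rfl fun c _ => ?_
  have : ∀ i ∈ T, (if ¬ p c i then (1 : ℤ) else 0) = -(if p c i then (1 : ℤ) else 0) + 1 := by
    intro i _
    by_cases h : p c i <;> simp [h]
  rw [Finset.prod_congr rfl this, Finset.prod_add_one]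
  refine Finset.sum_congr rfl fun S _ => ?_
  rw [Finset.prod_neg]

theorem aux_sum_card {α : Type*} (g : Finset α → ℤ) (T₁ T₂ : Finset α) (h : #T₁ = #T₂)
    (hg : ∀ S₁ S₂ : Finset α, #S₁ = #S₂ → #S₁ ≤ #T₁ → g S₁ = g S₂) :
    ∑ S ∈ T₁.powerset, (-1) ^ #S * g S = ∑ S ∈ T₂.powerset, (-1) ^ #S * g S := by
  classical
  let e := Finset.equivOfCardEq h
  have key : ∀ T : Finset α, #T = #T₁ → ∑ S ∈ T.powerset, (-1) ^ #S * g S =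
      ∑ m ∈ range (#T₁ + 1), (#T₁).choose m • ((-1) ^ m *
        (if hm : ∃ S : Finset α, #S = m then g hm.choose else 0)) := by
    intro T hT
    rw [← hT, ← Finset.sum_powerset_apply_card]
    refine Finset.sum_congr rfl fun S hS => ?_
    have hm : ∃ S' : Finset α, #S' = #S := ⟨S, rfl⟩
    rw [dif_pos hm]
    congr 1
    refine hg _ _ hm.choose_spec.symm ?_
    rw [← hT]
    exact Finset.card_le_card (Finset.mem_powerset.1 hS)
  rw [key T₁ rfl, key T₂ h.symm]

theorem auxN_eq [Fintype F] (C : Submodule F (ι → F)) (k : ℕ) (T : Finset ι) :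
    (auxN C k T : ℤ) = ∑ S ∈ T.powerset, (-1) ^ #S * (auxZ C k S : ℤ) := by
  classical
  have := aux_incl_excl (auxW C k) (fun c i => c i = 0) T
  unfold auxN auxZ
  convert this

theorem auxZ_eq [Fintype F] (C : Submodule F (ι → F)) (k : ℕ) (T : Finset ι) :
    (auxZ C k T : ℤ) = ∑ S ∈ T.powerset, (-1) ^ #S * (auxN C k S : ℤ) := by
  classical
  have := aux_incl_excl (auxW C k) (fun c i => c i ≠ 0) T
  simp only [not_not] at this
  unfold auxN auxZ
  convert this

open scoped Classical in
theorem aux_wt_eq (c : ι → F) : wt c = #{i | c i ≠ 0} := by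
  unfold wt
  rw [Nat.card_eq_fintype_card, Fintype.card_subtype]

theorem auxN_natCard [Fintype F] (C : Submodule F (ι → F)) (k : ℕ) (T : Finset ι) :
    Nat.card {c : C // wt (c : ι → F) = k ∧ ∀ i ∈ T, (c : ι → F) i ≠ 0} = auxN C k T := by
  classical
  unfold auxN auxW
  rw [Finset.filter_filter, ← Fintype.card_subtype, ← Nat.card_eq_fintype_card]
  refine Nat.card_congr ⟨fun c => ⟨c.1.1, ⟨c.1.2, c.2.1⟩, c.2.2⟩,
    fun c => ⟨⟨c.1, c.2.1.1⟩, c.2.1.2, c.2.2⟩, fun _ => rfl, fun _ => rfl⟩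

theorem aux_wt_restrict (T : Finset ι) (c : ι → F) (hc : ∀ i ∈ T, c i = 0) :
    wt (fun i : {i : ι // i ∉ T} => c i.1) = wt c := by
  unfold wt
  refine Nat.card_congr ⟨fun i => ⟨i.1.1, i.2⟩,
    fun i => ⟨⟨i.1, fun h => i.2 (hc _ h)⟩, i.2⟩, fun _ => rfl, fun _ => rfl⟩

theorem auxZ_natCard [Fintype F] (C : Submodule F (ι → F)) (k : ℕ) (T : Finset ι) :
    Acount (shortened C T) k = auxZ C k T := by
  classical
  unfold auxZ auxW Acount
  rw [Finset.filter_filter, ← Fintype.card_subtype, ← Nat.card_eq_fintype_card]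
  symm
  refine Nat.card_congr (Equiv.ofBijective
    (fun c => ⟨⟨fun i => c.1 i.1, ⟨c.1, ⟨c.2.1.1, c.2.2⟩, rfl⟩⟩, ?_⟩) ⟨?_, ?_⟩)
  · exact (aux_wt_restrict T c.1 c.2.2).trans c.2.1.2
  · intro c c' h
    have h' := congrArg (fun x => x.1.1) h
    apply Subtype.ext
    funext i
    by_cases hi : i ∈ T
    · rw [c.2.2 i hi, c'.2.2 i hi]
    · exact congrFun h' ⟨i, hi⟩
  · rintro ⟨⟨x, c, ⟨hc, hT⟩, rfl⟩, hk⟩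
    exact ⟨⟨c, ⟨hc, (aux_wt_restrict T c hT).symm.trans hk⟩, hT⟩, rfl⟩

theorem aux_wt_smul (a : F) (ha : a ≠ 0) (c : ι → F) : wt (a • c) = wt c := by
  unfold wt
  simp [ha]

theorem auxN_dvd [Fintype F] (C : Submodule F (ι → F)) (k : ℕ) (T : Finset ι)
    (hT : T.Nonempty) : (Fintype.card F - 1) ∣ auxN C k T := by
  classical
  obtain ⟨i₀, hi₀⟩ := hT
  rw [← auxN_natCard]
  let X := {c : C // wt (c : ι → F) = k ∧ ∀ i ∈ T, (c : ι → F) i ≠ 0}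
  let Y := {c : X // (c.1 : ι → F) i₀ = 1}
  have e : X ≃ Fˣ × Y :=
    { toFun := fun c => (Units.mk0 ((c.1 : ι → F) i₀) (c.2.2 i₀ hi₀),
        ⟨⟨((c.1 : ι → F) i₀)⁻¹ • c.1, by
          have h0 := c.2.2 i₀ hi₀
          refine ⟨?_, fun i hi => ?_⟩
          · rw [Submodule.coe_smul, aux_wt_smul _ (inv_ne_zero h0)]; exact c.2.1
          · simpa using ⟨h0, c.2.2 i hi⟩⟩, by
          have h0 := c.2.2 i₀ hi₀
          simp [h0]⟩)
      invFun := fun p => ⟨(p.1 : F) • p.2.1.1, by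
          refine ⟨?_, fun i hi => ?_⟩
          · rw [Submodule.coe_smul, aux_wt_smul _ p.1.ne_zero]; exact p.2.1.2.1
          · simpa using p.2.1.2.2 i hi⟩
      left_inv := fun c => by
        have h0 := c.2.2 i₀ hi₀
        apply Subtype.ext
        simp [h0]
      right_inv := fun p => by
        have h1 := p.2.2
        refine Prod.ext (Units.ext ?_) (Subtype.ext (Subtype.ext ?_))
        · simp [h1]
        · simp [h1] }
  change _ ∣ Nat.card X
  rw [Nat.card_congr e, Nat.card_prod, Nat.card_eq_fintype_card, Fintype.card_units]
  exact dvd_mul_right _ _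

theorem auxN_step [Fintype F] [DecidableEq ι] (C : Submodule F (ι → F)) (k : ℕ) (S : Finset ι) :
    ∑ i ∈ Sᶜ, auxN C k (insert i S) = (k - #S) * auxN C k S := by
  classical
  have h1 : ∀ i, auxN C k (insert i S) =
      ∑ c ∈ (auxW C k).filter (fun c => ∀ i ∈ S, c i ≠ 0), if c i ≠ 0 then 1 else 0 := by
    intro i
    unfold auxN
    rw [← Finset.card_filter, Finset.filter_filter]
    congr 1
    ext c
    simp only [Finset.mem_filter, Finset.forall_mem_insert]
    tauto
  simp_rw [h1]
  rw [Finset.sum_comm]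
  unfold auxN
  rw [mul_comm, ← smul_eq_mul, ← Finset.sum_const]
  refine Finset.sum_congr (by congr) fun c hc => ?_
  simp only [auxW, Finset.mem_filter, Finset.mem_univ, true_and] at hc
  rw [← Finset.card_filter, ← hc.1.2, aux_wt_eq, ← Finset.card_sdiff_of_subset]
  · congr 1
    ext i
    simp [and_comm]
  · intro i hi
    simpa using hc.2 i hi

theorem auxN_down [Fintype F] (C : Submodule F (ι → F)) (k t : ℕ) (hk : t ≤ k)
    (h : ∀ T₁ T₂ : Finset ι, #T₁ = t → #T₂ = t → auxN C k T₁ = auxN C k T₂) (n : ℕ) :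
    ∀ s, s + n = t → ∀ T₁ T₂ : Finset ι, #T₁ = s → #T₂ = s → auxN C k T₁ = auxN C k T₂ := by
  classical
  induction n with
  | zero => intro s hs; subst hs; exact h
  | succ n ih =>
    intro s hs T₁ T₂ h₁ h₂
    have ih' := ih (s + 1) (by omega)
    have hpos : 0 < k - s := by omega
    refine Nat.eq_of_mul_eq_mul_left hpos ?_
    have e₁ := auxN_step C k T₁
    have e₂ := auxN_step C k T₂
    rw [h₁] at e₁
    rw [h₂] at e₂
    rw [← e₁, ← e₂]
    have hc : #T₁ᶜ = #T₂ᶜ := by rw [Finset.card_compl, Finset.card_compl, h₁, h₂]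
    let e := Finset.equivOfCardEq hc
    rw [← Finset.sum_coe_sort T₁ᶜ, ← Finset.sum_coe_sort T₂ᶜ]
    refine Fintype.sum_equiv e _ _ fun x => ih' _ _ ?_ ?_
    · rw [Finset.card_insert_of_notMem (Finset.mem_compl.1 x.2), h₁]
    · rw [Finset.card_insert_of_notMem (Finset.mem_compl.1 (e x).2), h₂]

theorem auxN_small [Fintype F] (C : Submodule F (ι → F)) (d k : ℕ) (hd : IsMinDist C d)
    (hk : k < d) (T₁ T₂ : Finset ι) (h : #T₁ = #T₂) : auxN C k T₁ = auxN C k T₂ := by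
  classical
  rcases Finset.eq_empty_or_nonempty T₁ with h₁ | h₁
  · subst h₁
    rw [Finset.card_empty] at h
    rw [Finset.card_eq_zero.1 h.symm]
  · have h₂ : T₂.Nonempty := by
      rw [← Finset.card_pos, ← h]; exact Finset.card_pos.2 h₁
    have key : ∀ T : Finset ι, T.Nonempty → auxN C k T = 0 := by
      rintro T ⟨i, hi⟩
      unfold auxN auxW
      rw [Finset.card_eq_zero, Finset.filter_eq_empty_iff]
      intro c hc hne
      simp only [Finset.mem_filter, Finset.mem_univ, true_and] at hc
      have : c ≠ 0 := fun h0 => hne i hi (by rw [h0]; rfl)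
      have := hd.2 c hc.1 this
      omega
    rw [key _ h₁, key _ h₂]

theorem auxN_large [Fintype F] (C : Submodule F (ι → F)) (k : ℕ) (hk : Fintype.card ι < k)
    (T : Finset ι) : auxN C k T = 0 := by
  classical
  unfold auxN auxW
  rw [Finset.card_eq_zero, Finset.filter_eq_empty_iff]
  intro c hc
  simp only [Finset.mem_filter, Finset.mem_univ, true_and] at hc
  have h2 := hc.2
  rw [aux_wt_eq] at h2
  have := Finset.card_le_univ ({i | c i ≠ 0} : Finset ι)
  omega

/-- `C` supports `t`-designs at all weights `0 ≤ k ≤ v` iff for every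
`1 ≤ t' ≤ t` the weight distribution of the shortened code `C_T` is independent of the
choice of the `t'`-set `T`. -/
theorem supportsDesign_iff_shortened_wtd {F : Type*} [Field F] [Fintype F] {v : ℕ}
    (d dp t : ℕ) (C : Submodule F (Fin v → F))
    (hd : IsMinDist C d) (hdp : IsMinDist (dualCode C) dp)
    (ht0 : 0 < t) (ht : t < min d dp) :
    (∀ k : ℕ, k ≤ v → SupportsDesign t C k) ↔
    (∀ t' : ℕ, 1 ≤ t' → t' ≤ t →
      ∀ T₁ T₂ : Finset (Fin v), T₁.card = t' → T₂.card = t' →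
        ∀ k : ℕ, Acount (shortened C T₁) k = Acount (shortened C T₂) k) := by 
  have htd : t < d := lt_of_lt_of_le ht (min_le_left _ _)
  constructor
  · intro h t' _ ht't T₁ T₂ h₁ h₂ k
    rw [auxZ_natCard, auxZ_natCard]
    have hN : ∀ S₁ S₂ : Finset (Fin v), #S₁ = #S₂ → #S₁ ≤ t → auxN C k S₁ = auxN C k S₂ := by
      intro S₁ S₂ hS hSt
      rcases lt_or_ge k d with hk | hk
      · exact auxN_small C d k hd hk S₁ S₂ hS
      · rcases lt_or_ge v k with hv | hv
        · rw [auxN_large C k (by simpa using hv), auxN_large C k (by simpa using hv)]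
        · obtain ⟨lam, hlam⟩ := h k hv
          refine auxN_down C k t (by omega) ?_ (t - #S₁) (#S₁) (by omega) S₁ S₂ rfl hS.symm
          intro A B hA hB
          rw [← auxN_natCard, ← auxN_natCard, hlam A hA, hlam B hB]
    have := aux_sum_card (fun S => (auxN C k S : ℤ)) T₁ T₂ (h₁.trans h₂.symm) (by
      intro S₁ S₂ hS hle
      exact congrArg Nat.cast (hN S₁ S₂ hS (by omega)))
    have h3 : (auxZ C k T₁ : ℤ) = auxZ C k T₂ := by
      rw [auxZ_eq, auxZ_eq]; exact this
    exact_mod_cast h3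
  · intro h k _
    have hZ : ∀ S₁ S₂ : Finset (Fin v), #S₁ = #S₂ → #S₁ ≤ t → auxZ C k S₁ = auxZ C k S₂ := by
      intro S₁ S₂ hS hSt
      rcases Nat.eq_zero_or_pos (#S₁) with h0 | h0
      · rw [Finset.card_eq_zero.1 h0, Finset.card_eq_zero.1 (hS.symm.trans h0)]
      · rw [← auxZ_natCard, ← auxZ_natCard]
        exact h _ h0 hSt S₁ S₂ rfl hS.symm k
    by_cases hex : ∃ T₀ : Finset (Fin v), #T₀ = t
    · obtain ⟨T₀, hT₀⟩ := hex
      obtain ⟨lam, hlam⟩ := auxN_dvd C k T₀ (Finset.card_pos.1 (by omega))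
      refine ⟨lam, fun T hT => ?_⟩
      rw [auxN_natCard, ← hlam]
      have := aux_sum_card (fun S => (auxZ C k S : ℤ)) T T₀ (hT.trans hT₀.symm) (by
        intro S₁ S₂ hS hle
        exact congrArg Nat.cast (hZ S₁ S₂ hS (by omega)))
      have h3 : (auxN C k T : ℤ) = auxN C k T₀ := by
        rw [auxN_eq, auxN_eq]; exact this
      exact_mod_cast h3
    · exact ⟨0, fun T hT => absurd ⟨T, hT⟩ hex⟩
end

section
/- Let C be a [v, m, d] linear code over GF(q) with dual minimum distance d⊥ and 0 < t < min(d, d⊥). If the supports of codewords of each fixed weight in C form t-designs for all weights, then the supports of codewords of each fixed weight in the dual code C⊥ also form t-designs for all weights. -/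
open Finset

variable {F : Type*} [Field F] {ι : Type*} [Fintype ι]

section DualDesignHelpers

open Polynomial

/-- The support as a finset. -/
noncomputable def suppF {F : Type*} [Field F] {v : ℕ} (c : Fin v → F) : Finset (Fin v) := by
  classical exact univ.filter (fun i => c i ≠ 0)

theorem mem_suppF {F : Type*} [Field F] {v : ℕ} (c : Fin v → F) (i : Fin v) :
    i ∈ suppF c ↔ c i ≠ 0 := by
  simp [suppF]

theorem wt_eq_card_s13 {F : Type*} [Field F] {v : ℕ} (c : Fin v → F) :
    wt c = (suppF c).card := by
  classical
  simp [wt, suppF, Nat.card_eq_fintype_card, Fintype.card_subtype]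

theorem card_between {α : Type*} [DecidableEq α] (S U : Finset α) (t : ℕ) (hS : S ⊆ U)
    (hSt : S.card ≤ t) :
    ((powersetCard t U).filter (fun T => S ⊆ T)).card = (U.card - S.card).choose (t - S.card) := by
  rw [← card_sdiff_of_subset hS, ← card_powersetCard]
  refine card_bij' (fun T _ => T \ S) (fun R _ => R ∪ S) ?_ ?_ ?_ ?_
  · intro T hT
    simp only [mem_filter, mem_powersetCard] at hT ⊢
    exact ⟨sdiff_subset_sdiff hT.1.1 le_rfl, by rw [card_sdiff_of_subset hT.2, hT.1.2]⟩
  · intro R hR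
    simp only [mem_filter, mem_powersetCard] at hR ⊢
    refine ⟨⟨union_subset (hR.1.trans sdiff_subset) hS, ?_⟩, subset_union_right⟩
    rw [card_union_of_disjoint, hR.2]
    · omega
    · exact disjoint_of_subset_left hR.1 sdiff_disjoint
  · intro T hT
    simp only [mem_filter] at hT
    exact sdiff_union_of_subset hT.2
  · intro R hR
    simp only [mem_powersetCard] at hR
    exact union_sdiff_cancel_right (disjoint_of_subset_left hR.1 sdiff_disjoint)

/-- Number of words of weight `k` in `X` whose support contains `S`. -/
noncomputable def Mcount {F : Type*} [Field F] {v : ℕ} (X : Finset (Fin v → F)) (k : ℕ)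
    (S : Finset (Fin v)) : ℕ := by
  classical exact (X.filter (fun c => wt c = k ∧ S ⊆ suppF c)).card

theorem Mcount_congr {F : Type*} [Field F] {v : ℕ} (X : Finset (Fin v → F)) (t : ℕ)
    (hX : ∀ c ∈ X, c ≠ 0 → t < wt c) (htv : t ≤ v)
    (hdes : ∀ k (T T' : Finset (Fin v)), T.card = t → T'.card = t → Mcount X k T = Mcount X k T')
    (k : ℕ) (S S' : Finset (Fin v)) (h : S.card = S'.card) (hS : S.card ≤ t) :
    Mcount X k S = Mcount X k S' := by
  classical
  by_cases hk : k < t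
  · unfold Mcount
    congr 1
    apply filter_congr
    intro c hc
    have key : wt c = k → suppF c = ∅ := by
      intro hw
      by_contra hne
      have : c ≠ 0 := by
        rintro rfl
        apply hne
        ext i
        simp [mem_suppF]
      have := hX c hc this
      omega
    constructor
    · rintro ⟨h1, h2⟩
      rw [key h1, subset_empty] at h2 ⊢
      rw [h2, card_empty] at h
      exact ⟨h1, card_eq_zero.mp h.symm⟩
    · rintro ⟨h1, h2⟩
      rw [key h1, subset_empty] at h2 ⊢
      rw [h2, card_empty] at h
      exact ⟨h1, card_eq_zero.mp h⟩
  · push Not at hk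
    obtain ⟨T0, -, hT0⟩ := exists_subset_card_eq (s := (univ : Finset (Fin v))) (n := t) (by simpa)
    have main : ∀ S : Finset (Fin v), S.card ≤ t →
        (v - S.card).choose (t - S.card) * Mcount X k T0
          = Mcount X k S * (k - S.card).choose (t - S.card) := by
      intro S hS
      have h1 : ∑ T ∈ (powersetCard t univ).filter (fun T => S ⊆ T), Mcount X k T
          = (v - S.card).choose (t - S.card) * Mcount X k T0 := by
        rw [sum_congr rfl (g := fun _ => Mcount X k T0), sum_const, card_between _ _ _ (subset_univ _) hS]
        · simp
        · intro T hT
          simp only [mem_filter, mem_powersetCard] at hT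
          exact hdes k _ _ hT.1.2 hT0
      rw [← h1]
      unfold Mcount
      simp_rw [card_filter _ X]
      rw [sum_comm, sum_mul]
      apply sum_congr rfl
      intro c hc
      rw [← card_filter]
      by_cases hc2 : wt c = k ∧ S ⊆ suppF c
      · rw [if_pos hc2, one_mul, ← hc2.1, wt_eq_card_s13, ← card_between _ _ _ hc2.2 hS]
        congr 1
        ext T
        simp only [mem_filter, mem_powersetCard, subset_univ, true_and]
        have := hc2.1
        have := wt_eq_card_s13 c
        tauto
      · rw [if_neg hc2, zero_mul, card_eq_zero, filter_eq_empty_iff]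
        intro T hT hT2
        simp only [mem_filter] at hT
        exact hc2 ⟨hT2.1, hT.2.trans hT2.2⟩
    have e1 := main S hS
    have e2 := main S' (h ▸ hS)
    rw [← h, e1] at e2
    exact Nat.eq_of_mul_eq_mul_right (Nat.choose_pos (by omega)) e2

theorem sum_choose {F : Type*} [Field F] {v : ℕ} (X : Finset (Fin v → F)) (k j : ℕ)
    (T : Finset (Fin v)) [DecidablePred fun c : Fin v → F => wt c = k] :
    ∑ c ∈ X.filter (fun c => wt c = k), (T ∩ suppF c).card.choose j
      = ∑ S ∈ powersetCard j T, Mcount X k S := by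
  classical
  unfold Mcount
  simp_rw [← filter_filter]
  simp_rw [card_filter _ (filter _ X)]
  rw [sum_comm]
  apply sum_congr (by congr)
  intro c hc
  rw [← card_filter, ← card_powersetCard]
  congr 1
  ext S
  simp only [mem_filter, mem_powersetCard, subset_inter_iff]
  tauto

theorem sum_G_congr {F : Type*} [Field F] {v : ℕ} {R : Type*} [CommRing R]
    (X : Finset (Fin v → F)) (t : ℕ)
    (hX : ∀ c ∈ X, c ≠ 0 → t < wt c) (htv : t ≤ v)
    (hdes : ∀ k (T T' : Finset (Fin v)), T.card = t → T'.card = t → Mcount X k T = Mcount X k T')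
    (G : ℕ → ℕ → R) (T T' : Finset (Fin v)) (hT : T.card = t) (hT' : T'.card = t) :
    ∑ c ∈ X, G (T ∩ suppF c).card (wt c) = ∑ c ∈ X, G (T' ∩ suppF c).card (wt c) := by
  classical
  obtain ⟨T0, -, hT0⟩ := exists_subset_card_eq (s := (univ : Finset (Fin v))) (n := t) (by simpa)
  have main : ∀ T : Finset (Fin v), T.card = t → 
      ∑ c ∈ X, G (T ∩ suppF c).card (wt c) = ∑ k ∈ X.image wt, ∑ j ∈ range (t+1),
        (∑ S ∈ powersetCard j T, Mcount X k S) • ((fwdDiff 1)^[j] (fun a => G a k) 0) := by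
    intro T hT
    rw [← sum_fiberwise_of_maps_to (g := wt) (t := X.image wt) (fun c hc => mem_image_of_mem _ hc)]
    apply sum_congr rfl
    intro k _
    simp_rw [← sum_choose, sum_smul]
    rw [sum_comm]
    apply sum_congr (by congr)
    intro c hc
    simp only [mem_filter] at hc
    rw [hc.2]
    have hle : (T ∩ suppF c).card ≤ t := hT ▸ card_le_card inter_subset_left
    have := shift_eq_sum_fwdDiff_iter (1 : ℕ) (fun a => G a k) (T ∩ suppF c).card 0
    simp only [zero_add, smul_eq_mul, mul_one] at this
    rw [this]
    apply sum_subset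
    · intro i; simp only [mem_range]; omega
    · intro j _ hj
      simp only [mem_range] at hj
      rw [Nat.choose_eq_zero_of_lt (by omega), zero_smul]
  rw [main T hT, main T' hT']
  refine sum_congr rfl fun k _ => sum_congr rfl fun j hj => ?_
  congr 1
  simp only [mem_range] at hj
  obtain ⟨S0, hS0, hS0c⟩ := exists_subset_card_eq (s := T0) (n := j) (by omega)
  have e : ∀ T : Finset (Fin v), T.card = t → 
      ∑ S ∈ powersetCard j T, Mcount X k S = t.choose j * Mcount X k S0 := by
    intro T hT
    rw [sum_congr rfl (g := fun _ => Mcount X k S0), sum_const, card_powersetCard, hT, smul_eq_mul]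
    intro S hS
    simp only [mem_powersetCard] at hS
    exact Mcount_congr X t hX htv hdes k _ _ (by omega) (by omega)
  rw [e T hT, e T' hT']

theorem sum_char_dual {F : Type*} [Field F] [Fintype F] {v : ℕ} (C : Submodule F (Fin v → F))
    [DecidablePred (· ∈ C)] [DecidablePred (· ∈ dualCode C)] (ψ : AddChar F ℂ) (hψ : ψ.IsPrimitive)
    (x : Fin v → F) :
    ∑ c with c ∈ C, ψ (∑ i, x i * c i) =
      if x ∈ dualCode C then (((univ.filter (· ∈ C)).card : ℕ) : ℂ) else 0 := by
  split_ifs with h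
  · rw [sum_congr rfl (g := fun _ => (1 : ℂ))]
    · simp
    · intro c hc
      rw [h c (by simpa using hc), AddChar.map_zero_eq_one]
  · have : ∃ c ∈ C, ∑ i, x i * c i ≠ 0 := by
      by_contra hcon
      push Not at hcon
      exact h hcon
    obtain ⟨c0, hc0, hne⟩ := this
    have h1 := hψ hne
    rw [AddChar.ne_one_iff] at h1
    obtain ⟨a, ha⟩ := h1
    rw [AddChar.mulShift_apply] at ha
    have key : ∑ c with c ∈ C, ψ (∑ i, x i * c i) =
        ψ ((∑ i, x i * c0 i) * a) * ∑ c with c ∈ C, ψ (∑ i, x i * c i) := by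
      rw [mul_sum]
      refine sum_bij' (fun c _ => c - a • c0) (fun c _ => c + a • c0) ?_ ?_ ?_ ?_ ?_
      · intro c hc
        simp only [mem_filter, mem_univ, true_and] at hc ⊢
        exact C.sub_mem hc (C.smul_mem _ hc0)
      · intro c hc
        simp only [mem_filter, mem_univ, true_and] at hc ⊢
        exact C.add_mem hc (C.smul_mem _ hc0)
      · intro c _; simp
      · intro c _; simp
      · intro c _
        rw [← AddChar.map_add_eq_mul]
        congr 1
        rw [sum_mul, ← sum_add_distrib]
        apply sum_congr rfl
        intro i _
        simp only [Pi.sub_apply, Pi.smul_apply, smul_eq_mul]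
        ring
    by_contra hz
    exact ha (mul_right_cancel₀ hz (by rw [one_mul]; exact key.symm))

/-- local factor -/
noncomputable def hloc {F : Type*} [Field F] {v : ℕ} (T : Finset (Fin v)) (i : Fin v) (y : F) :
    ℂ[X] := by
  classical exact if y = 0 then (if i ∈ T then 0 else 1) else X

theorem prod_hloc {F : Type*} [Field F] {v : ℕ} (T : Finset (Fin v)) (x : Fin v → F)
    [Decidable (T ⊆ suppF x)] :
    ∏ i, hloc T i (x i) = if T ⊆ suppF x then X ^ wt x else 0 := by
  classical
  split_ifs with h
  · rw [wt_eq_card_s13, ← prod_const, ← prod_subset (subset_univ (suppF x))]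
    · apply prod_congr rfl
      intro i hi
      rw [mem_suppF] at hi
      simp [hloc, hi]
    · intro i _ hi
      have : i ∉ T := fun hh => hi (h hh)
      rw [mem_suppF, not_not] at hi
      simp [hloc, hi, this]
  · rw [not_subset] at h
    obtain ⟨i, hi, hi2⟩ := h
    apply prod_eq_zero (mem_univ i)
    rw [mem_suppF, not_not] at hi2
    simp [hloc, hi, hi2]

theorem sum_hloc {F : Type*} [Field F] [Fintype F] [DecidableEq F] {v : ℕ} (T : Finset (Fin v))
    (i : Fin v) (ψ : AddChar F ℂ) (hψ : ψ.IsPrimitive) (b : F) :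
    ∑ y : F, hloc T i y * Polynomial.C (ψ (y * b)) =
      (if i ∈ T then 0 else 1) +
        X * Polynomial.C ((if b = 0 then (Fintype.card F : ℂ) else 0) - 1) := by
  classical
  have h := AddChar.sum_mulShift b hψ
  have h2 : ∀ y : F, hloc T i y * Polynomial.C (ψ (y * b)) =
      X * Polynomial.C (ψ (y * b)) +
        (if y = 0 then ((if i ∈ T then 0 else 1) - X : ℂ[X]) else 0) := by
    intro y
    by_cases hy : y = 0
    · simp [hloc, hy]
    · simp [hloc, hy]
  simp_rw [h2]
  rw [sum_add_distrib, ← mul_sum, ← map_sum, h]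
  simp only [sum_ite_eq', mem_univ, if_true, map_sub, map_one]
  push_cast
  ring

/-- The transform value. -/
noncomputable def Gval (q : ℂ) (t v a k : ℕ) : ℂ[X] :=
  (X * Polynomial.C (0 - 1)) ^ a * (X * Polynomial.C (q - 1)) ^ (t - a) *
    ((1 + X * Polynomial.C (0 - 1)) ^ (k - a) * (1 + X * Polynomial.C (q - 1)) ^ (v - t - (k - a)))

theorem transform_eq {F : Type*} [Field F] [Fintype F] {v : ℕ} (T : Finset (Fin v))
    (ψ : AddChar F ℂ) (hψ : ψ.IsPrimitive) (c : Fin v → F) :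
    ∑ x : Fin v → F, (∏ i, hloc T i (x i)) * Polynomial.C (ψ (∑ i, x i * c i)) =
      Gval (Fintype.card F) T.card v (T ∩ suppF c).card (wt c) := by
  classical
  have h1 : ∀ x : Fin v → F, (∏ i, hloc T i (x i)) * Polynomial.C (ψ (∑ i, x i * c i)) =
      ∏ i, (hloc T i (x i) * Polynomial.C (ψ (x i * c i))) := by
    intro x
    have hs : ∀ s : Finset (Fin v), ψ (∑ i ∈ s, x i * c i) = ∏ i ∈ s, ψ (x i * c i) := by
      intro s
      induction s using Finset.induction_on with
      | empty => simp
      | insert a s ha ih => rw [sum_insert ha, prod_insert ha, AddChar.map_add_eq_mul, ih]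
    rw [prod_mul_distrib, ← map_prod, hs]
  simp_rw [h1]
  rw [← Fintype.piFinset_univ, ← prod_univ_sum (fun _ => univ)
    (fun i y => hloc T i y * Polynomial.C (ψ (y * c i)))]
  simp_rw [sum_hloc T _ ψ hψ]
  rw [← prod_mul_prod_compl T]
  have eT : ∏ i ∈ T, ((if i ∈ T then 0 else 1) +
        X * Polynomial.C ((if c i = 0 then (Fintype.card F : ℂ) else 0) - 1)) =
      ∏ i ∈ T, (if i ∈ suppF c then (X * Polynomial.C (0 - 1) : ℂ[X]) else
        X * Polynomial.C ((Fintype.card F : ℂ) - 1)) := by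
    apply prod_congr rfl
    intro i hi
    by_cases hc : c i = 0 <;> simp [hi, hc, mem_suppF]
  have eN : ∏ i ∈ Tᶜ, ((if i ∈ T then 0 else 1) +
        X * Polynomial.C ((if c i = 0 then (Fintype.card F : ℂ) else 0) - 1)) =
      ∏ i ∈ Tᶜ, (if i ∈ suppF c then (1 + X * Polynomial.C (0 - 1) : ℂ[X]) else
        1 + X * Polynomial.C ((Fintype.card F : ℂ) - 1)) := by
    apply prod_congr rfl
    intro i hi
    rw [mem_compl] at hi
    by_cases hc : c i = 0 <;> simp [hi, hc, mem_suppF]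
  rw [eT, eN, prod_ite, prod_ite, prod_const, prod_const, prod_const, prod_const]
  have c1 : (T.filter (· ∈ suppF c)).card = (T ∩ suppF c).card := by
    rw [filter_mem_eq_inter]
  have c2 : (T.filter (· ∉ suppF c)).card = T.card - (T ∩ suppF c).card := by
    have := card_filter_add_card_filter_not (s := T) (· ∈ suppF c)
    omega
  have c3 : (Tᶜ.filter (· ∈ suppF c)).card = wt c - (T ∩ suppF c).card := by
    have h3 := card_filter_add_card_filter_not (s := suppF c) (· ∈ T)
    have h4 : (suppF c).filter (· ∈ T) = T ∩ suppF c := by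
      ext; simp; tauto
    have h5 : (suppF c).filter (· ∉ T) = Tᶜ.filter (· ∈ suppF c) := by
      ext; simp; tauto
    rw [h4, h5] at h3
    rw [wt_eq_card_s13]
    omega
  have c4 : (Tᶜ.filter (· ∉ suppF c)).card = v - T.card - (wt c - (T ∩ suppF c).card) := by
    have h3 := card_filter_add_card_filter_not (s := Tᶜ) (· ∈ suppF c)
    rw [card_compl, Fintype.card_fin] at h3
    omega
  rw [c1, c2, c3, c4]
  rfl

theorem poisson {F : Type*} [Field F] [Fintype F] {v : ℕ} (C : Submodule F (Fin v → F))
    [DecidablePred (· ∈ C)] [DecidablePred (· ∈ dualCode C)] (T : Finset (Fin v)) :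
    Polynomial.C (((univ.filter (· ∈ C)).card : ℕ) : ℂ) *
        ∑ x with x ∈ dualCode C, ∏ i, hloc T i (x i) =
      ∑ c with c ∈ C, Gval (Fintype.card F) T.card v (T ∩ suppF c).card (wt c) := by
  classical
  obtain ⟨ψ, hψ⟩ : ∃ ψ : AddChar F ℂ, ψ.IsPrimitive :=
    ⟨_, AddChar.FiniteField.primitiveChar_to_Complex_isPrimitive F⟩
  simp_rw [← transform_eq T ψ hψ]
  rw [sum_comm]
  simp_rw [← mul_sum, ← map_sum, sum_char_dual C ψ hψ]
  rw [mul_sum, sum_filter]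
  apply sum_congr rfl
  intro x _
  split_ifs
  · rw [mul_comm]
  · simp

theorem coeff_sum_dual {F : Type*} [Field F] {v : ℕ} (X : Finset (Fin v → F)) (T : Finset (Fin v))
    (k : ℕ) : (∑ x ∈ X, ∏ i, hloc T i (x i)).coeff k = (Mcount X k T : ℂ) := by
  classical
  simp_rw [prod_hloc]
  rw [finsetSum_coeff, Mcount, card_filter]
  push_cast
  apply sum_congr (by congr)
  intro c _
  by_cases h : T ⊆ suppF c
  · simp [h, coeff_X_pow, eq_comm]
  · simp [h]

theorem card_eq_Mcount {F : Type*} [Field F] [Fintype F] {v : ℕ} (C : Submodule F (Fin v → F))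
    [DecidablePred (· ∈ C)] (k : ℕ) (T : Finset (Fin v)) :
    Nat.card {c : C // wt (c : Fin v → F) = k ∧ ∀ i ∈ T, (c : Fin v → F) i ≠ 0} =
      Mcount (univ.filter (· ∈ C)) k T := by
  classical
  rw [Mcount, filter_filter, ← Fintype.card_subtype, ← Nat.card_eq_fintype_card]
  refine Nat.card_congr
    { toFun := fun c => ⟨c.1.1, c.1.2, c.2.1, fun i hi => (mem_suppF _ _).2 (c.2.2 i hi)⟩
      invFun := fun c => ⟨⟨c.1, c.2.1⟩, c.2.2.1, fun i hi => (mem_suppF _ _).1 (c.2.2.2 hi)⟩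
      left_inv := fun _ => rfl
      right_inv := fun _ => rfl }

theorem dvd_card {F : Type*} [Field F] [Fintype F] {v : ℕ} (C : Submodule F (Fin v → F))
    (k : ℕ) (T : Finset (Fin v)) (hT : T.Nonempty) :
    Fintype.card F - 1 ∣
      Nat.card {c : C // wt (c : Fin v → F) = k ∧ ∀ i ∈ T, (c : Fin v → F) i ≠ 0} := by
  classical
  obtain ⟨i0, hi0⟩ := hT
  have hw : ∀ (u : F) (c : Fin v → F), u ≠ 0 → wt (u • c) = wt c := by
    intro u c hu
    simp [wt, hu]
  let e : {c : C // wt (c : Fin v → F) = k ∧ ∀ i ∈ T, (c : Fin v → F) i ≠ 0} ≃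
      Fˣ × {c : C // (wt (c : Fin v → F) = k ∧ ∀ i ∈ T, (c : Fin v → F) i ≠ 0) ∧
        (c : Fin v → F) i0 = 1} :=
    { toFun := fun c => (Units.mk0 (c.1.1 i0) (c.2.2 i0 hi0),
        ⟨(c.1.1 i0)⁻¹ • c.1, ⟨⟨by
          have := hw (c.1.1 i0)⁻¹ c.1.1 (inv_ne_zero (c.2.2 i0 hi0))
          exact this.trans c.2.1, fun i hi =>
            mul_ne_zero (inv_ne_zero (c.2.2 i0 hi0)) (c.2.2 i hi)⟩,
          inv_mul_cancel₀ (c.2.2 i0 hi0)⟩⟩)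
      invFun := fun p => ⟨(p.1 : F) • p.2.1, ⟨(hw p.1 p.2.1.1 p.1.ne_zero).trans p.2.2.1.1,
        fun i hi => mul_ne_zero p.1.ne_zero (p.2.2.1.2 i hi)⟩⟩
      left_inv := by
        intro c
        apply Subtype.ext
        simp [smul_smul, mul_inv_cancel₀ (c.2.2 i0 hi0)]
      right_inv := by
        rintro ⟨u, ⟨c, hc, h1⟩⟩
        ext <;> simp [h1, smul_smul] }
  rw [Nat.card_congr e, Nat.card_prod, Nat.card_eq_fintype_card, Fintype.card_units]
  exact dvd_mul_right _ _

end DualDesignHelpers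


/-- if the supports of codewords of each fixed weight in `C` form
`t`-designs for all weights, then so do those of the dual code `C⊥`. -/
theorem dual_supportsDesign {F : Type*} [Field F] [Fintype F] {v : ℕ}
    (d dp t : ℕ) (C : Submodule F (Fin v → F))
    (hd : IsMinDist C d) (hdp : IsMinDist (dualCode C) dp)
    (ht0 : 0 < t) (ht : t < min d dp)
    (hdes : ∀ k : ℕ, SupportsDesign t C k) :
    ∀ k : ℕ, SupportsDesign t (dualCode C) k := by
  classical
  intro k
  by_cases htv : t ≤ v
  swap
  · refine ⟨0, fun T hT => ?_⟩
    have := card_le_univ T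
    rw [Fintype.card_fin] at this
    omega
  have hX : ∀ c ∈ univ.filter (· ∈ C), c ≠ 0 → t < wt c := by
    intro c hc h0
    simp only [mem_filter, mem_univ, true_and] at hc
    exact lt_of_lt_of_le (lt_of_lt_of_le ht (min_le_left _ _)) (hd.2 c hc h0)
  have hM : ∀ k (T T' : Finset (Fin v)), T.card = t → T'.card = t →
      Mcount (univ.filter (· ∈ C)) k T = Mcount (univ.filter (· ∈ C)) k T' := by
    intro k T T' hT hT'
    obtain ⟨lam, hlam⟩ := hdes k
    rw [← card_eq_Mcount, ← card_eq_Mcount, hlam T hT, hlam T' hT']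
  have hcard : (((univ.filter (· ∈ C)).card : ℕ) : ℂ) ≠ 0 := by
    rw [Nat.cast_ne_zero, card_ne_zero]
    exact ⟨0, by simp⟩
  have hD : ∀ T T' : Finset (Fin v), T.card = t → T'.card = t →
      Mcount (univ.filter (· ∈ dualCode C)) k T = Mcount (univ.filter (· ∈ dualCode C)) k T' := by
    intro T T' hT hT'
    have h1 := poisson C T
    have h2 := poisson C T'
    rw [hT] at h1
    rw [hT'] at h2
    have h3 := sum_G_congr _ t hX htv hM
      (fun a k => Gval (Fintype.card F : ℂ) t v a k) T T' hT hT'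
    have h4 := (h1.trans h3).trans h2.symm
    have h5 := congrArg (fun p => Polynomial.coeff p k) h4
    simp only [Polynomial.coeff_C_mul, coeff_sum_dual] at h5
    exact_mod_cast mul_left_cancel₀ hcard h5
  obtain ⟨T0, -, hT0⟩ := exists_subset_card_eq (s := (univ : Finset (Fin v))) (n := t) (by simpa)
  obtain ⟨lam, hlam⟩ := dvd_card (dualCode C) k T0 (card_pos.mp (by omega))
  refine ⟨lam, fun T hT => ?_⟩
  rw [← hlam, card_eq_Mcount, card_eq_Mcount]
  exact hD T T0 hT hT0
end

section
/- Let F: GF(2^n) → GF(2^n) be a function, and let C(F)⊥ be the dual of the binary code C(F) = {(Tr(aF(x) + bx) + c)_{x ∈ GF(2^n)} : a, b ∈ GF(2^n), c ∈ GF(2)}. For any two distinct points x1, x2 ∈ GF(2^n), the number of weight-4 codewords of C(F)⊥ whose support contains {x1, x2} equals (δ(x1 + x2, F(x1) + F(x2)) - 2)/2, where δ(a,b) = #{x : F(x+a) + F(x) = b}. -/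
open Finset

variable {F : Type*} [Field F] {ι : Type*} [Fintype ι]

open Classical in
theorem aux_mem_dual {K : Type*} [Field K] [Fintype K] [Algebra (ZMod 2) K] (Fv : K → K)
    (c : K → ZMod 2) :
    c ∈ dualCode (Submodule.span (ZMod 2) (Set.range fun p : K × K × ZMod 2 =>
      fun x : K => Algebra.trace (ZMod 2) K (p.1 * Fv x + p.2.1 * x) + p.2.2)) ↔
    (∑ x, c x • Fv x = 0 ∧ ∑ x, c x • x = 0 ∧ ∑ x, c x = 0) := by
  have key : ∀ a b : K, ∀ d : ZMod 2,
      ∑ x, c x * (Algebra.trace (ZMod 2) K (a * Fv x + b * x) + d) =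
      Algebra.trace (ZMod 2) K (a * ∑ x, c x • Fv x) +
      Algebra.trace (ZMod 2) K (b * ∑ x, c x • x) + (∑ x, c x) * d := by
    intro a b d
    simp only [Finset.mul_sum, Finset.sum_mul, map_sum, mul_smul_comm, map_smul, smul_eq_mul,
      ← Finset.sum_add_distrib, map_add, mul_add]
  have nd : ∀ y : K, (∀ a : K, Algebra.trace (ZMod 2) K (a * y) = 0) → y = 0 := by
    intro y hy
    have := (traceForm_nondegenerate (ZMod 2) K)
    refine this.2 y fun a => ?_
    simpa [Algebra.traceForm_apply] using hy a
  constructor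
  · intro h
    have h' : ∀ a b : K, ∀ d : ZMod 2, Algebra.trace (ZMod 2) K (a * ∑ x, c x • Fv x) +
      Algebra.trace (ZMod 2) K (b * ∑ x, c x • x) + (∑ x, c x) * d = 0 := by
      intro a b d
      rw [← key]
      exact h _ (Submodule.subset_span ⟨(a, b, d), rfl⟩)
    refine ⟨nd _ fun a => ?_, nd _ fun b => ?_, ?_⟩
    · simpa using h' a 0 0
    · simpa using h' 0 b 0
    · simpa using h' 0 0 1
  · rintro ⟨h1, h2, h3⟩ e he
    induction he using Submodule.span_induction with
    | mem x hx =>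
      obtain ⟨⟨a, b, d⟩, rfl⟩ := hx
      simp only [key, h1, h2, h3]
      simp
    | zero => simp
    | add x y _ _ hx hy => simp [mul_add, Finset.sum_add_distrib, hx, hy]
    | smul a x _ hx =>
      simp only [Pi.smul_apply, smul_eq_mul, mul_left_comm _ a, ← Finset.mul_sum, hx, mul_zero]

open Classical in
theorem aux_supp {K : Type*} [Field K] [Fintype K] [Algebra (ZMod 2) K] (Fv : K → K)
    (c : K → ZMod 2) : ∑ x, c x • Fv x = ∑ x ∈ univ.filter (fun x => c x ≠ 0), Fv x := by
  rw [Finset.sum_filter]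
  refine Finset.sum_congr rfl fun x _ => ?_
  have : ∀ z : ZMod 2, z = 0 ∨ z = 1 := by decide
  rcases this (c x) with h | h <;> simp [h]

open Classical in
theorem aux_count {K : Type*} [Field K] [Fintype K] [Algebra (ZMod 2) K] (Fv : K → K)
    (x1 x2 : K) (hne : x1 ≠ x2) :
    Nat.card {c : dualCode (Submodule.span (ZMod 2) (Set.range fun p : K × K × ZMod 2 =>
      fun x : K => Algebra.trace (ZMod 2) K (p.1 * Fv x + p.2.1 * x) + p.2.2)) //
        wt (c : K → ZMod 2) = 4 ∧
        (c : K → ZMod 2) x1 ≠ 0 ∧ (c : K → ZMod 2) x2 ≠ 0} =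
    (univ.filter (fun s : Finset K => s.card = 4 ∧ x1 ∈ s ∧ x2 ∈ s ∧
      ∑ x ∈ s, Fv x = 0 ∧ ∑ x ∈ s, x = 0)).card := by
  have hz : ∀ z : ZMod 2, z = 0 ∨ z = 1 := by decide
  have hw : ∀ c : K → ZMod 2, wt c = (univ.filter (fun x => c x ≠ 0)).card := by
    intro c
    rw [wt, Nat.card_eq_fintype_card, Fintype.card_subtype]
  rw [← Fintype.card_subtype, ← Nat.card_eq_fintype_card]
  refine Nat.card_eq_of_bijective (fun c => ⟨univ.filter (fun x => c.1.1 x ≠ 0), ?_⟩) ⟨?_, ?_⟩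
  · obtain ⟨⟨c, hc⟩, h4, h1, h2⟩ := c
    rw [aux_mem_dual] at hc
    refine ⟨by rw [← hw]; exact h4, by simpa using h1, by simpa using h2, ?_, ?_⟩
    · rw [← aux_supp]; exact hc.1
    · rw [← aux_supp (fun x => x)]; exact hc.2.1
  · rintro ⟨⟨c, hc⟩, h⟩ ⟨⟨d, hd⟩, h'⟩ he
    simp only [Subtype.mk.injEq, Finset.ext_iff, mem_filter, mem_univ, true_and] at he
    simp only [Subtype.mk.injEq]
    funext x
    have := he x
    rcases hz (c x) with h | h <;> rcases hz (d x) with h' | h' <;> simp_all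
  · rintro ⟨s, h4, h1, h2, hF, hs⟩
    have hf : univ.filter (fun x => (if x ∈ s then (1 : ZMod 2) else 0) ≠ 0) = s := by
      ext x; simp
    refine ⟨⟨⟨fun x => if x ∈ s then 1 else 0, ?_⟩, ?_, ?_, ?_⟩, ?_⟩
    · rw [aux_mem_dual]
      refine ⟨?_, ?_, ?_⟩
      · rw [aux_supp, hf, hF]
      · rw [aux_supp (fun x => x), hf, hs]
      · simp [h4]; decide
    · rw [hw, hf, h4]
    · simp [h1]
    · simp [h2]
    · exact Subtype.ext hf

open Classical in
theorem aux_double {K : Type*} [Field K] [Fintype K] [CharP K 2] (Fv : K → K)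
    (x1 x2 : K) (hne : x1 ≠ x2) :
    (univ.filter (fun s : Finset K => s.card = 4 ∧ x1 ∈ s ∧ x2 ∈ s ∧
      ∑ x ∈ s, Fv x = 0 ∧ ∑ x ∈ s, x = 0)).card * 2 =
    ((univ.filter (fun x : K => Fv (x + (x1 + x2)) + Fv x = Fv x1 + Fv x2)) \ {x1, x2}).card * 1 := by
  have e0 : ∀ a b : K, a + b = 0 ↔ a = b := fun a b => CharTwo.add_eq_zero
  have key : ∀ s : Finset K, s.card = 4 → x1 ∈ s → x2 ∈ s → ∑ x ∈ s, x = 0 → ∀ x ∈ s,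
      x ≠ x1 → x ≠ x2 → s = {x1, x2, x, x + (x1 + x2)} ∧
        ∑ x ∈ s, Fv x = Fv x1 + (Fv x2 + (Fv x + Fv (x + (x1 + x2)))) := by
    intro s h4 h1 h2 hs x hx n1 n2
    have hsub : ({x1, x2, x} : Finset K) ⊆ s := by
      intro y hy; simp at hy; rcases hy with rfl | rfl | rfl <;> assumption
    have h3 : ({x1, x2, x} : Finset K).card = 3 := by
      rw [Finset.card_eq_three]; exact ⟨x1, x2, x, hne, (Ne.symm n1), (Ne.symm n2), rfl⟩
    have hc : (s \ {x1, x2, x}).card = 1 := by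
      rw [Finset.card_sdiff_of_subset hsub, h4, h3]
    obtain ⟨y, hy⟩ := Finset.card_eq_one.1 hc
    have hy' : y ∈ s \ {x1, x2, x} := by rw [hy]; simp
    simp only [mem_sdiff, mem_insert, mem_singleton, not_or] at hy'
    obtain ⟨_, m1, m2, m3⟩ := hy'
    have hse : s = {x1, x2, x, y} := by
      rw [← Finset.sdiff_union_of_subset hsub, hy]
      ext z; simp; tauto
    have hsum : ∀ f : K → K, ∑ z ∈ s, f z = f x1 + (f x2 + (f x + f y)) := by
      intro f
      rw [hse, Finset.sum_insert, Finset.sum_insert, Finset.sum_insert, Finset.sum_singleton]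
      · simpa using (Ne.symm m3)
      · simpa using ⟨(Ne.symm n2), (Ne.symm m2)⟩
      · simpa using ⟨hne, (Ne.symm n1), (Ne.symm m1)⟩
    have hyx : y = x + (x1 + x2) := by
      have := hsum (fun z => z)
      rw [hs] at this
      symm
      rw [← e0, this]; ring
    subst hyx
    exact ⟨hse, hsum Fv⟩
  refine Finset.card_mul_eq_card_mul (fun (s : Finset K) x => x ∈ s) ?_ ?_
  · intro s hs
    simp only [mem_filter, mem_univ, true_and] at hs
    obtain ⟨h4, h1, h2, hF, hs⟩ := hs
    have hsub : ({x1, x2} : Finset K) ⊆ s := by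
      intro y hy; simp at hy; rcases hy with rfl | rfl <;> assumption
    have : Finset.bipartiteAbove (fun (s : Finset K) x => x ∈ s)
      ((univ.filter (fun x : K => Fv (x + (x1 + x2)) + Fv x = Fv x1 + Fv x2)) \ {x1, x2}) s
      = s \ {x1, x2} := by
      ext x
      simp only [Finset.mem_bipartiteAbove, mem_sdiff, mem_filter, mem_univ, true_and, mem_insert,
        mem_singleton, not_or]
      constructor
      · tauto
      · rintro ⟨hx, n1, n2⟩
        refine ⟨⟨?_, n1, n2⟩, hx⟩
        have := (key s h4 h1 h2 hs x hx n1 n2).2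
        rw [hF] at this
        rw [← e0, this]; ring
    rw [this, Finset.card_sdiff_of_subset hsub, h4, Finset.card_pair hne]
  · intro x hx
    simp only [mem_sdiff, mem_filter, mem_univ, true_and, mem_insert,
        mem_singleton, not_or] at hx
    obtain ⟨hx, n1, n2⟩ := hx
    rw [Finset.card_eq_one]
    refine ⟨{x1, x2, x, x + (x1 + x2)}, ?_⟩
    ext s
    simp only [Finset.mem_bipartiteBelow, mem_filter, mem_univ, true_and, mem_singleton]
    constructor
    · rintro ⟨⟨h4, h1, h2, hF, hs⟩, hxs⟩
      exact (key s h4 h1 h2 hs x hxs n1 n2).1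
    · rintro rfl
      have a1 : x1 ∉ ({x2, x, x + (x1 + x2)} : Finset K) := by
        simp only [mem_insert, mem_singleton, not_or]
        refine ⟨hne, (Ne.symm n1), fun h => n2 ?_⟩
        rw [← e0]; linear_combination - h
      have a2 : x2 ∉ ({x, x + (x1 + x2)} : Finset K) := by
        simp only [mem_insert, mem_singleton, not_or]
        refine ⟨(Ne.symm n2), fun h => n1 ?_⟩
        rw [← e0]; linear_combination - h
      have a3 : x ∉ ({x + (x1 + x2)} : Finset K) := by
        simp only [mem_singleton]
        intro h
        apply hne
        rw [← e0]; linear_combination - h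
      have hsum : ∀ f : K → K, ∑ z ∈ ({x1, x2, x, x + (x1 + x2)} : Finset K), f z =
          f x1 + (f x2 + (f x + f (x + (x1 + x2)))) := by
        intro f
        rw [Finset.sum_insert a1, Finset.sum_insert a2, Finset.sum_insert a3, Finset.sum_singleton]
      refine ⟨⟨?_, by simp, by simp, ?_, ?_⟩, by simp⟩
      · rw [Finset.card_insert_of_notMem a1, Finset.card_insert_of_notMem a2,
          Finset.card_insert_of_notMem a3, Finset.card_singleton]
      · rw [hsum, ← CharTwo.add_self_eq_zero (Fv x1 + Fv x2)]
        linear_combination hx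
      · rw [hsum, ← CharTwo.add_self_eq_zero (x1 + x2 + x)]
        ring

/-- the number of weight-4 codewords of `C(F)⊥` whose support contains two
distinct points `x1, x2` equals `(δ(x1 + x2, F(x1) + F(x2)) - 2)/2`. -/
theorem weight_four_dual_count (n : ℕ) (hn : 0 < n)
    (K : Type*) [Field K] [Fintype K] [Algebra (ZMod 2) K]
    (hK : Fintype.card K = 2 ^ n) (Fv : K → K)
    (CF : Submodule (ZMod 2) (K → ZMod 2))
    (hCF : CF = Submodule.span (ZMod 2) (Set.range fun p : K × K × ZMod 2 =>
      fun x : K => Algebra.trace (ZMod 2) K (p.1 * Fv x + p.2.1 * x) + p.2.2))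
    (x1 x2 : K) (hne : x1 ≠ x2) :
    Nat.card {c : dualCode CF // wt (c : K → ZMod 2) = 4 ∧
        (c : K → ZMod 2) x1 ≠ 0 ∧ (c : K → ZMod 2) x2 ≠ 0} =
      (Nat.card {x : K // Fv (x + (x1 + x2)) + Fv x = Fv x1 + Fv x2} - 2) / 2 := by
  classical
  subst hCF
  have : CharP K 2 := charP_of_injective_algebraMap (algebraMap (ZMod 2) K).injective 2
  rw [aux_count Fv x1 x2 hne]
  have h := aux_double Fv x1 x2 hne
  have hsub : ({x1, x2} : Finset K) ⊆
      univ.filter (fun x : K => Fv (x + (x1 + x2)) + Fv x = Fv x1 + Fv x2) := by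
    intro y hy
    simp only [mem_insert, mem_singleton] at hy
    simp only [mem_filter, mem_univ, true_and]
    rcases hy with rfl | rfl
    · rw [← add_assoc, CharTwo.add_self_eq_zero, zero_add, add_comm]
    · rw [add_comm x1, ← add_assoc, CharTwo.add_self_eq_zero, zero_add]
  rw [Finset.card_sdiff_of_subset hsub, Finset.card_pair hne] at h
  rw [Nat.card_eq_fintype_card, Fintype.card_subtype]
  omega
end

section
/- Let F: GF(2^n) → GF(2^n) be differentially two-valued with values {0, 2^s}. Then the supports of the weight-4 codewords of C(F)⊥ form a 2-(2^n, 4, 2^{s-1} - 1) design on the point set GF(2^n). In particular, they form a Steiner system S(2, 4, 2^n) if and only if F is differentially two-valued with values {0, 4}. -/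
open Finset

variable {F : Type*} [Field F] {ι : Type*} [Fintype ι]

theorem aux_count_s17 {K : Type*} [Field K] [Fintype K] [DecidableEq K] [CharP K 2] (Fv : K → K)
    (u v : K) (huv : u ≠ v) :
    (univ.filter (fun B : Finset K => B.card = 4 ∧ u ∈ B ∧ v ∈ B ∧ ∑ x ∈ B, x = 0 ∧
      ∑ x ∈ B, Fv x = 0)).card * 2 =
    (((univ.filter (fun x : K => Fv (x + (u + v)) + Fv x = Fv u + Fv v)).erase u).erase v).card
      := by
  have h2 : (2 : K) = 0 := CharTwo.two_eq_zero
  have key := Finset.card_mul_eq_card_mul (m := 2) (n := 1)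
    (s := univ.filter (fun B : Finset K => B.card = 4 ∧ u ∈ B ∧ v ∈ B ∧ ∑ x ∈ B, x = 0 ∧
      ∑ x ∈ B, Fv x = 0))
    (t := ((univ.filter (fun x : K => Fv (x + (u + v)) + Fv x = Fv u + Fv v)).erase u).erase v)
    (fun B x => x ∈ B) ?_ ?_
  · simpa using key
  · intro B hB
    simp only [mem_filter, mem_univ, true_and] at hB
    obtain ⟨hc, hu, hv, hs1, hs2⟩ := hB
    have hv' : v ∈ B.erase u := mem_erase.2 ⟨huv.symm, hv⟩
    have hc2 : ((B.erase u).erase v).card = 2 := by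
      rw [card_erase_of_mem hv', card_erase_of_mem hu, hc]
    rw [← hc2]
    congr 1
    obtain ⟨x, y, hxy, hE⟩ := card_eq_two.1 hc2
    rw [← add_sum_erase _ _ hu, ← add_sum_erase _ _ hv', hE, sum_pair hxy] at hs1 hs2
    have hy : y = x + (u + v) := by linear_combination hs1 - (u + v + x) * h2
    have hx : x = y + (u + v) := by linear_combination hs1 - (u + v + y) * h2
    have hmem : ∀ z, z ∈ (B.erase u).erase v ↔ z = x ∨ z = y := by
      intro z; rw [hE]; simp
    ext z
    simp only [bipartiteAbove, mem_filter, mem_univ, true_and, mem_erase]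
    constructor
    · rintro ⟨⟨h1, h3, h4⟩, h5⟩
      exact ⟨h1, h3, h5⟩
    · rintro ⟨h1, h3, h5⟩
      refine ⟨⟨h1, h3, ?_⟩, h5⟩
      have := (hmem z).1 (mem_erase.2 ⟨h1, mem_erase.2 ⟨h3, h5⟩⟩)
      rcases this with rfl | rfl
      · rw [← hy]; linear_combination hs2 - (Fv u + Fv v) * h2
      · rw [← hx]; linear_combination hs2 - (Fv u + Fv v) * h2
  · intro x hx
    simp only [mem_filter, mem_univ, true_and, mem_erase] at hx
    obtain ⟨hxv, hxu, hx⟩ := hx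
    rw [card_eq_one]
    have hyu : x + (u + v) ≠ u := by
      intro h; exact hxv (by linear_combination h - v * h2)
    have hyv : x + (u + v) ≠ v := by
      intro h; exact hxu (by linear_combination h - u * h2)
    have hyx : x + (u + v) ≠ x := by
      intro h; exact huv (by linear_combination h - v * h2)
    refine ⟨{u, v, x, x + (u + v)}, ?_⟩
    have hn1 : u ∉ ({v, x, x + (u + v)} : Finset K) := by
      simp only [mem_insert, mem_singleton, not_or]
      exact ⟨huv, hxu.symm, hyu.symm⟩
    have hn2 : v ∉ ({x, x + (u + v)} : Finset K) := by
      simp only [mem_insert, mem_singleton, not_or]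
      exact ⟨hxv.symm, hyv.symm⟩
    have hcard : ({u, v, x, x + (u + v)} : Finset K).card = 4 := by
      rw [card_insert_of_notMem hn1, card_insert_of_notMem hn2, card_pair hyx.symm]
    ext B
    simp only [bipartiteBelow, mem_filter, mem_univ, true_and, mem_singleton]
    constructor
    · rintro ⟨⟨hc, hu, hv, hs1, hs2⟩, hxB⟩
      symm
      apply eq_of_subset_of_card_le
      · have hv' : v ∈ B.erase u := mem_erase.2 ⟨huv.symm, hv⟩
        have hx' : x ∈ (B.erase u).erase v := mem_erase.2 ⟨hxv, mem_erase.2 ⟨hxu, hxB⟩⟩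
        have hc1 : (((B.erase u).erase v).erase x).card = 1 := by
          rw [card_erase_of_mem hx', card_erase_of_mem hv', card_erase_of_mem hu, hc]
        obtain ⟨y, hE⟩ := card_eq_one.1 hc1
        rw [← add_sum_erase _ _ hu, ← add_sum_erase _ _ hv', ← add_sum_erase _ _ hx', hE,
          sum_singleton] at hs1
        have hy : x + (u + v) = y := by linear_combination hs1 - y * h2
        have hyB : y ∈ ((B.erase u).erase v).erase x := by rw [hE]; simp
        have hyB' : y ∈ B := mem_of_mem_erase (mem_of_mem_erase (mem_of_mem_erase hyB))
        rw [hy]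
        intro z hz
        simp only [mem_insert, mem_singleton] at hz
        rcases hz with rfl | rfl | rfl | rfl <;> assumption
      · rw [hcard, hc]
    · rintro rfl
      refine ⟨⟨hcard, by simp, by simp, ?_, ?_⟩, by simp⟩
      · rw [sum_insert hn1, sum_insert hn2, sum_pair hyx.symm]
        linear_combination (u + v + x) * h2
      · rw [sum_insert hn1, sum_insert hn2, sum_pair hyx.symm]
        linear_combination hx + (Fv u + Fv v) * h2

theorem aux_zmod2 (a : ZMod 2) : a ≠ 0 → a = 1 := by
  revert a; decide

theorem aux_trace {K : Type*} [Field K] [Fintype K] [Algebra (ZMod 2) K] (w : K)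
    (h : ∀ p : K, Algebra.trace (ZMod 2) K (p * w) = 0) : w = 0 := by
  by_contra hw
  have h1 : Algebra.trace (ZMod 2) K = 0 := by
    ext y
    have := h (y * w⁻¹)
    rwa [mul_assoc, inv_mul_cancel₀ hw, mul_one] at this
  exact Algebra.trace_ne_zero (ZMod 2) K h1

theorem aux_dual {K : Type*} [Field K] [Fintype K] [DecidableEq K] [Algebra (ZMod 2) K]
    (Fv : K → K) (CF : Submodule (ZMod 2) (K → ZMod 2))
    (hCF : CF = Submodule.span (ZMod 2) (Set.range fun p : K × K × ZMod 2 =>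
      fun x : K => Algebra.trace (ZMod 2) K (p.1 * Fv x + p.2.1 * x) + p.2.2))
    (B : Finset K) (hB : B.card = 4) :
    (fun x => if x ∈ B then (1 : ZMod 2) else 0) ∈ dualCode CF ↔
      (∑ x ∈ B, x = 0 ∧ ∑ x ∈ B, Fv x = 0) := by
  have hsum : ∀ p : K × K × ZMod 2, ∑ i, (if i ∈ B then (1 : ZMod 2) else 0) *
      (Algebra.trace (ZMod 2) K (p.1 * Fv i + p.2.1 * i) + p.2.2) =
      Algebra.trace (ZMod 2) K (p.1 * ∑ x ∈ B, Fv x + p.2.1 * ∑ x ∈ B, x) := by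
    intro p
    have h4 : (4 : ZMod 2) = 0 := by decide
    simp only [ite_mul, one_mul, zero_mul, sum_ite_mem, univ_inter, sum_add_distrib, sum_const,
      hB, mul_sum, map_add, map_sum]
    simp [h4]
  constructor
  · intro h
    have h' : ∀ p : K × K × ZMod 2,
      Algebra.trace (ZMod 2) K (p.1 * ∑ x ∈ B, Fv x + p.2.1 * ∑ x ∈ B, x) = 0 := by
      intro p
      rw [← hsum]
      exact h _ (by rw [hCF]; exact Submodule.subset_span ⟨p, rfl⟩)
    constructor
    · apply aux_trace
      intro p
      simpa using h' (0, p, 0)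
    · apply aux_trace
      intro p
      simpa using h' (p, 0, 0)
  · rintro ⟨h1, h2⟩ c hc
    rw [hCF] at hc
    induction hc using Submodule.span_induction with
    | mem x hx =>
      obtain ⟨p, rfl⟩ := hx
      have := hsum p
      rw [h1, h2] at this
      simpa using this
    | zero => simp
    | add x y _ _ hx hy =>
      simp only [Pi.add_apply, mul_add, sum_add_distrib, hx, hy, add_zero]
    | smul a x _ hx =>
      simp only [Pi.smul_apply, smul_eq_mul, mul_left_comm _ a, ← mul_sum, hx, mul_zero]

theorem aux_card {K : Type*} [Field K] [Fintype K] [DecidableEq K] [Algebra (ZMod 2) K]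
    (Fv : K → K) (CF : Submodule (ZMod 2) (K → ZMod 2))
    (hCF : CF = Submodule.span (ZMod 2) (Set.range fun p : K × K × ZMod 2 =>
      fun x : K => Algebra.trace (ZMod 2) K (p.1 * Fv x + p.2.1 * x) + p.2.2))
    (u v : K) :
    Nat.card {c : dualCode CF // wt (c : K → ZMod 2) = 4 ∧
          ∀ i ∈ ({u, v} : Finset K), (c : K → ZMod 2) i ≠ 0} =
    (univ.filter (fun B : Finset K => B.card = 4 ∧ u ∈ B ∧ v ∈ B ∧ ∑ x ∈ B, x = 0 ∧
      ∑ x ∈ B, Fv x = 0)).card := by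
  have hwt : ∀ c : K → ZMod 2, wt c = (univ.filter (fun x => c x ≠ 0)).card := by
    intro c
    rw [wt, Nat.card_eq_fintype_card, Fintype.card_subtype]
  have hind : ∀ c : K → ZMod 2,
      (fun x => if x ∈ univ.filter (fun x => c x ≠ 0) then (1 : ZMod 2) else 0) = c := by
    intro c
    ext x
    by_cases h : c x = 0
    · simp [h]
    · simp [aux_zmod2 _ h]
  have hsupp : ∀ B : Finset K,
      univ.filter (fun x => (if x ∈ B then (1 : ZMod 2) else 0) ≠ 0) = B := by
    intro B
    ext x
    simp
  rw [← Fintype.card_subtype, ← Nat.card_eq_fintype_card]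
  refine Nat.card_congr
    { toFun := fun c => ⟨univ.filter (fun x => c.1.1 x ≠ 0), ?_⟩
      invFun := fun B => ⟨⟨fun x => if x ∈ B.1 then (1 : ZMod 2) else 0,
        (aux_dual Fv CF hCF B.1 B.2.1).2 B.2.2.2.2⟩, ?_, ?_⟩
      left_inv := ?_
      right_inv := ?_ }
  · obtain ⟨⟨c, hc⟩, h4, hT⟩ := c
    have hcard : (univ.filter (fun x => c x ≠ 0)).card = 4 := by rw [← hwt]; exact h4
    have hd := aux_dual Fv CF hCF _ hcard
    rw [hind] at hd
    refine ⟨hcard, ?_, ?_, hd.1 hc⟩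
    · simpa using hT u (by simp)
    · simpa using hT v (by simp)
  · rw [hwt, hsupp]
    exact B.2.1
  · intro i hi
    have : i ∈ B.1 := by
      simp only [mem_insert, mem_singleton] at hi
      rcases hi with rfl | rfl
      · exact B.2.2.1
      · exact B.2.2.2.1
    simp [this]
  · intro c
    apply Subtype.ext
    apply Subtype.ext
    exact hind _
  · intro B
    apply Subtype.ext
    exact hsupp _

/-- if `F` is differentially two-valued with values `{0, 2^s}`, then the
supports of the weight-4 codewords of `C(F)⊥` form a `2`-`(2^n, 4, 2^{s-1} - 1)` design;
in particular they form a Steiner system `S(2, 4, 2^n)` iff `2^s = 4`. -/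
theorem weight_four_dual_design (n s : ℕ) (hn : 0 < n) (hs : 1 ≤ s)
    (K : Type*) [Field K] [Fintype K] [Algebra (ZMod 2) K]
    (hK : Fintype.card K = 2 ^ n) (Fv : K → K)
    (htwo : {d : ℕ | ∃ a b : K, a ≠ 0 ∧
        Nat.card {x : K // Fv (x + a) + Fv x = b} = d} = {0, 2 ^ s})
    (CF : Submodule (ZMod 2) (K → ZMod 2))
    (hCF : CF = Submodule.span (ZMod 2) (Set.range fun p : K × K × ZMod 2 =>
      fun x : K => Algebra.trace (ZMod 2) K (p.1 * Fv x + p.2.1 * x) + p.2.2)) :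
    (∀ T : Finset K, T.card = 2 →
      Nat.card {c : dualCode CF // wt (c : K → ZMod 2) = 4 ∧
          ∀ i ∈ T, (c : K → ZMod 2) i ≠ 0} = 2 ^ (s - 1) - 1) ∧
    ((∀ T : Finset K, T.card = 2 →
      Nat.card {c : dualCode CF // wt (c : K → ZMod 2) = 4 ∧
          ∀ i ∈ T, (c : K → ZMod 2) i ≠ 0} = 1) ↔ (2 : ℕ) ^ s = 4) := by
  classical
  haveI : CharP K 2 := charP_of_injective_algebraMap (algebraMap (ZMod 2) K).injective 2
  have h2 : (2 : K) = 0 := CharTwo.two_eq_zero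
  have main : ∀ T : Finset K, T.card = 2 →
      Nat.card {c : dualCode CF // wt (c : K → ZMod 2) = 4 ∧
          ∀ i ∈ T, (c : K → ZMod 2) i ≠ 0} = 2 ^ (s - 1) - 1 := by
    intro T hT
    obtain ⟨u, v, huv, rfl⟩ := card_eq_two.1 hT
    rw [aux_card Fv CF hCF u v]
    have hc := aux_count_s17 Fv u v huv
    have hu : u ∈ univ.filter (fun x : K => Fv (x + (u + v)) + Fv x = Fv u + Fv v) := by
      have : u + (u + v) = v := by linear_combination u * h2
      simp [this, add_comm]
    have hv : v ∈ univ.filter (fun x : K => Fv (x + (u + v)) + Fv x = Fv u + Fv v) := by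
      have : v + (u + v) = u := by linear_combination v * h2
      simp [this]
    have hS : (univ.filter (fun x : K => Fv (x + (u + v)) + Fv x = Fv u + Fv v)).card = 2 ^ s := by
      have hmem : (univ.filter (fun x : K => Fv (x + (u + v)) + Fv x = Fv u + Fv v)).card ∈
          ({0, 2 ^ s} : Set ℕ) := by
        rw [← htwo]
        refine ⟨u + v, Fv u + Fv v, ?_, ?_⟩
        · intro h
          exact huv (by linear_combination h - v * h2)
        · rw [Nat.card_eq_fintype_card, Fintype.card_subtype]
      rcases hmem with h | h
      · exact absurd h (card_ne_zero_of_mem hu)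
      · exact h
    rw [card_erase_of_mem (mem_erase.2 ⟨huv.symm, hv⟩), card_erase_of_mem hu, hS] at hc
    obtain ⟨t, rfl⟩ : ∃ t, s = t + 1 := ⟨s - 1, by omega⟩
    rw [pow_succ] at hc
    simp only [Nat.add_sub_cancel]
    omega
  refine ⟨main, ?_⟩
  obtain ⟨t, rfl⟩ : ∃ t, s = t + 1 := ⟨s - 1, by omega⟩
  simp only [Nat.add_sub_cancel] at main
  have hpow : (2 : ℕ) ^ (t + 1) = 2 ^ t * 2 := pow_succ _ _
  constructor
  · intro h
    obtain ⟨T, -, hT⟩ := exists_subset_card_eq (s := (univ : Finset K)) (n := 2) (by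
      rw [card_univ, hK]
      exact Nat.le_self_pow hn.ne' 2)
    have := h T hT
    rw [main T hT] at this
    omega
  · intro h T hT
    rw [main T hT]
    omega
end
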